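/- arXiv:2509.06935 — 2 statements merged into one kernel-verified Lean document; each statement's English description precedes it below -/
import Mathlib

section
/- Let d, k, r be positive integers with k < d and r ≥ k + 2. Define f_{d,k,r}(n) = n^{d(1 - k/(r-1))} if r ≤ d; f_{d,k,r}(n) = n^{d-k}/(log n)^{1/d} if r = d + 1; and f_{d,k,r}(n) = n^{d-k} if r > d + 1. Then there exist a constant c > 0 and N ∈ ℕ such that for every n ≥ N there is a subset S of [n]^d with |S| ≥ c · f_{d,k,r}(n) such that no r points of S lie in a common affine subspace of ℝ^d of dimension at most k. -/
/-- The grid `[n]^d`: points of `ℝ^d` with all coordinates integers in `{1, …, n}`. -/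
def grid (d n : ℕ) : Set (EuclideanSpace ℝ (Fin d)) :=
  {x | ∀ i, ∃ m : ℕ, 1 ≤ m ∧ m ≤ n ∧ x i = (m : ℝ)}

/-- The function `f_{d,k,r}(n)` from Theorem 1.1. -/
noncomputable def fdkr (d k r n : ℕ) : ℝ :=
  if r ≤ d then (n : ℝ) ^ ((d : ℝ) * (1 - (k : ℝ) / ((r : ℝ) - 1)))
  else if r = d + 1 then (n : ℝ) ^ ((d : ℝ) - (k : ℝ)) / Real.log n ^ ((1 : ℝ) / (d : ℝ))
  else (n : ℝ) ^ ((d : ℝ) - (k : ℝ))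

def LocFin {E : Type} [NormedAddCommGroup E] (L : AddSubgroup E) : Prop :=
  ∀ R : ℝ, {v | v ∈ L ∧ ‖v‖ ≤ R}.Finite

lemma exists_shortest {E : Type} [NormedAddCommGroup E] (L : AddSubgroup E) (hL : LocFin L)
    (w : E) (hw : w ∈ L) (hw0 : w ≠ 0) :
    ∃ a ∈ L, a ≠ 0 ∧ ∀ v ∈ L, v ≠ 0 → ‖a‖ ≤ ‖v‖ := by
  have hf : {v | (v ∈ L ∧ ‖v‖ ≤ ‖w‖) ∧ v ≠ 0}.Finite := (hL ‖w‖).subset (fun v hv => hv.1)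
  obtain ⟨a, ha, hmin⟩ := Set.exists_min_image _ (fun v => ‖v‖) hf ⟨w, ⟨hw, le_rfl⟩, hw0⟩
  refine ⟨a, ha.1.1, ha.2, fun v hv hv0 => ?_⟩
  by_cases h : ‖v‖ ≤ ‖w‖
  · exact hmin v ⟨⟨hv, h⟩, hv0⟩
  · exact ha.1.2.trans (not_le.mp h).le

/-- every lattice of rank `k` has a `C`-good basis -/
def GoodBasis (k : ℕ) (C : ℝ) : Prop :=
  ∀ (E : Type) [NormedAddCommGroup E] [NormedSpace ℝ E] [FiniteDimensional ℝ E]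
    (L : AddSubgroup E), LocFin L → Submodule.span ℝ (L : Set E) = ⊤ → Module.finrank ℝ E = k →
    ∃ b : Fin k → E, (∀ i, b i ∈ L) ∧ (∀ i, b i ≠ 0) ∧
      ∀ v ∈ L, ∃ c : Fin k → ℤ, v = ∑ i, c i • b i ∧ ∀ i, |(c i : ℝ)| * ‖b i‖ ≤ C * ‖v‖

lemma norm_lift_le {E : Type} [NormedAddCommGroup E] [NormedSpace ℝ E]
    (L : AddSubgroup E) (a : E) (haL : a ∈ L)
    (hmin : ∀ v ∈ L, v ≠ 0 → ‖a‖ ≤ ‖v‖) (φ : E →ₗ[ℝ] ℝ) (hφ : ∀ x, |φ x| ≤ ‖x‖)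
    (hφa : |φ a| = ‖a‖) (β : E) (hβ : β ∈ L) (hβa : β ∉ Submodule.span ℝ {a})
    (hφβ : |φ β| ≤ ‖a‖ / 2) (t : ℝ) : ‖β‖ ≤ 3 * ‖β + t • a‖ := by
  set q := ‖β + t • a‖ with hq
  have h1 : ‖a‖ ≤ ‖β + (round t : ℤ) • a‖ := by
    apply hmin
    · exact L.add_mem hβ (L.zsmul_mem haL _)
    · intro h
      apply hβa
      rw [Submodule.mem_span_singleton]
      refine ⟨-(round t : ℝ), ?_⟩
      rw [neg_smul, Int.cast_smul_eq_zsmul]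
      exact (eq_neg_of_add_eq_zero_left h).symm
  have h2 : ‖β + (round t : ℤ) • a‖ ≤ q + ‖a‖ / 2 := by
    have : β + (round t : ℤ) • a = (β + t • a) - (t - round t) • a := by
      rw [sub_smul, Int.cast_smul_eq_zsmul]; abel
    rw [this]
    refine (norm_sub_le _ _).trans ?_
    rw [norm_smul, Real.norm_eq_abs]
    have := abs_sub_round t
    have := norm_nonneg a
    nlinarith
  have h3 : |t| * ‖a‖ ≤ q + ‖a‖ / 2 := by
    have : t * φ a = φ (β + t • a) - φ β := by simp
    rw [← hφa, ← abs_mul, this]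
    refine (abs_sub _ _).trans ?_
    have := hφ (β + t • a)
    rw [hφa]
    linarith
  have h4 : ‖β‖ ≤ q + |t| * ‖a‖ := by
    have : β = (β + t • a) - t • a := by abel
    calc ‖β‖ = ‖(β + t • a) - t • a‖ := by rw [← this]
      _ ≤ _ := norm_sub_le _ _
      _ = _ := by rw [norm_smul, Real.norm_eq_abs]
  linarith

lemma good_step (k : ℕ) (C : ℝ) (hC : 0 ≤ C) (hG : GoodBasis k C)
    (E : Type) [NormedAddCommGroup E] [NormedSpace ℝ E] [FiniteDimensional ℝ E]
    (L : AddSubgroup E) (hL : LocFin L) (hspan : Submodule.span ℝ (L : Set E) = ⊤)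
    (hk : Module.finrank ℝ E = k + 1) (a : E) (haL : a ∈ L) (ha0 : a ≠ 0)
    (hmin : ∀ v ∈ L, v ≠ 0 → ‖a‖ ≤ ‖v‖) (φ : E →ₗ[ℝ] ℝ) (hφ : ∀ x, |φ x| ≤ ‖x‖)
    (hφa : |φ a| = ‖a‖) :
    ∃ b : Fin k → E, (∀ i, b i ∈ L) ∧ (∀ i, b i ≠ 0) ∧ (∀ i, |φ (b i)| ≤ ‖a‖ / 2) ∧
      ∀ v ∈ L, ∃ (c₀ : ℤ) (c : Fin k → ℤ), v = c₀ • a + ∑ i, c i • b i ∧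
        |(c₀ : ℝ)| * ‖a‖ ≤ (1 + 3 * k * C) * ‖v‖ ∧
        ∀ i, |(c i : ℝ)| * ‖b i‖ ≤ 3 * C * ‖v‖ := by
  set W := Submodule.span ℝ {a} with hW
  have hapos : 0 < ‖a‖ := norm_pos_iff.mpr ha0
  have hcl : IsClosed (W : Set E) := W.closed_of_finiteDimensional
  have hcontr : ∀ x : E, ‖W.mkQ x‖ ≤ ‖x‖ := fun x => Submodule.Quotient.norm_mk_le W x
  -- near-minimal lifts
  have hlift : ∀ (x : E) (ε : ℝ), 0 < ε → ∃ t : ℝ, ‖x + t • a‖ < ‖W.mkQ x‖ + ε := by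
    intro x ε hε
    obtain ⟨y, hy, hyn⟩ := Submodule.Quotient.norm_mk_lt (S := W) (W.mkQ x) hε
    have : y - x ∈ W := (Submodule.Quotient.eq W).mp hy
    obtain ⟨t, ht⟩ := Submodule.mem_span_singleton.mp this
    exact ⟨t, by rw [ht]; simpa using hyn⟩
  have hround : ∀ (x : E) (t : ℝ), ‖x + (round t : ℤ) • a‖ ≤ ‖x + t • a‖ + ‖a‖ / 2 := by
    intro x t
    have : x + (round t : ℤ) • a = (x + t • a) - (t - round t) • a := by
      rw [sub_smul, Int.cast_smul_eq_zsmul]; abel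
    rw [this]
    refine (norm_sub_le _ _).trans ?_
    rw [norm_smul, Real.norm_eq_abs]
    have := abs_sub_round t
    have := norm_nonneg a
    nlinarith
  have hza : ∀ z : ℤ, W.mkQ (z • a) = 0 := by
    intro z
    rw [← Int.cast_smul_eq_zsmul ℝ]
    simp only [Submodule.mkQ_apply, Submodule.Quotient.mk_eq_zero]
    exact W.smul_mem _ (Submodule.mem_span_singleton_self a)
  let L' : AddSubgroup (E ⧸ W) := L.map W.mkQ.toAddMonoidHom
  have hL' : LocFin L' := by
    intro R
    refine ((hL (R + 1 + ‖a‖ / 2)).image W.mkQ).subset ?_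
    rintro v ⟨⟨x, hx, rfl⟩, hv⟩
    obtain ⟨t, ht⟩ := hlift x 1 one_pos
    refine ⟨x + (round t : ℤ) • a, ⟨L.add_mem hx (L.zsmul_mem haL _), ?_⟩, ?_⟩
    · have := hround x t
      have hv' : ‖W.mkQ x‖ ≤ R := hv
      linarith
    · rw [map_add, hza, add_zero]; rfl
  have hspan' : Submodule.span ℝ (L' : Set (E ⧸ W)) = ⊤ := by
    have : (L' : Set (E ⧸ W)) = W.mkQ '' (L : Set E) := rfl
    rw [this, Submodule.span_image, hspan, Submodule.map_top, Submodule.range_mkQ]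
  have hk' : Module.finrank ℝ (E ⧸ W) = k := by
    have h1 := Submodule.finrank_quotient_add_finrank W
    have h2 : Module.finrank ℝ W = 1 := finrank_span_singleton ha0
    omega
  obtain ⟨b', hb'L, hb'0, hb'⟩ := hG (E ⧸ W) L' hL' hspan' hk'
  have hex : ∀ i, ∃ β ∈ L, W.mkQ β = b' i ∧ |φ β| ≤ ‖a‖ / 2 := by
    intro i
    obtain ⟨x, hx, hxb⟩ := hb'L i
    have hφa0 : φ a ≠ 0 := by rw [← abs_pos, hφa]; exact hapos
    refine ⟨x - (round (φ x / φ a) : ℤ) • a, L.sub_mem hx (L.zsmul_mem haL _), ?_, ?_⟩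
    · rw [map_sub, hza, sub_zero]; exact hxb
    · rw [← Int.cast_smul_eq_zsmul ℝ, map_sub, map_smul, smul_eq_mul]
      have : φ x - (round (φ x / φ a) : ℝ) * φ a = (φ x / φ a - round (φ x / φ a)) * φ a := by
        field_simp
      rw [this, abs_mul, hφa]
      have := abs_sub_round (φ x / φ a)
      nlinarith
  choose b hbL hbb hφb using hex
  have hbW : ∀ i, b i ∉ W := by
    intro i h
    apply hb'0 i
    rw [← hbb i]
    simpa using h
  have hb3 : ∀ i, ‖b i‖ ≤ 3 * ‖b' i‖ := by
    intro i
    apply le_of_forall_pos_le_add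
    intro ε hε
    obtain ⟨t, ht⟩ := hlift (b i) (ε / 3) (by positivity)
    have := norm_lift_le L a haL hmin φ hφ hφa (b i) (hbL i) (hbW i) (hφb i) t
    rw [hbb] at ht
    linarith
  refine ⟨b, hbL, ?_, hφb, ?_⟩
  · intro i h
    exact hbW i (h ▸ W.zero_mem)
  intro v hv
  obtain ⟨c, hvc, hc⟩ := hb' (W.mkQ v) ⟨v, hv, rfl⟩
  have hci : ∀ i, |(c i : ℝ)| * ‖b i‖ ≤ 3 * C * ‖v‖ := by
    intro i
    have h1 := hc i
    have h2 := hb3 i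
    have h3 := hcontr v
    have h4 := abs_nonneg (c i : ℝ)
    calc |(c i : ℝ)| * ‖b i‖ ≤ |(c i : ℝ)| * (3 * ‖b' i‖) := by gcongr
      _ = 3 * (|(c i : ℝ)| * ‖b' i‖) := by ring
      _ ≤ 3 * (C * ‖W.mkQ v‖) := by gcongr
      _ ≤ 3 * (C * ‖v‖) := by gcongr
      _ = _ := by ring
  set w := v - ∑ i, c i • b i with hw
  have hwL : w ∈ L := L.sub_mem hv (L.sum_mem fun i _ => L.zsmul_mem (hbL i) _)
  have hwW : w ∈ W := by
    rw [← Submodule.Quotient.mk_eq_zero, ← Submodule.mkQ_apply, hw, map_sub, map_sum, hvc]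
    simp [map_zsmul, ← hbb]
  obtain ⟨t, ht⟩ := Submodule.mem_span_singleton.mp hwW
  have hwa : w = (round t : ℤ) • a := by
    by_contra hne
    have h1 := hmin (w - (round t : ℤ) • a) (L.sub_mem hwL (L.zsmul_mem haL _)) (sub_ne_zero.mpr hne)
    have h2 : w - (round t : ℤ) • a = (t - round t) • a := by
      rw [← ht, sub_smul, Int.cast_smul_eq_zsmul]
    rw [h2, norm_smul, Real.norm_eq_abs] at h1
    have := abs_sub_round t
    nlinarith
  refine ⟨round t, c, ?_, ?_, hci⟩
  · rw [← hwa, hw]; abel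
  · have h1 : |((round t : ℤ) : ℝ)| * ‖a‖ = ‖w‖ := by
      rw [hwa, ← Int.cast_smul_eq_zsmul ℝ, norm_smul, Real.norm_eq_abs]
    rw [h1]
    calc ‖w‖ ≤ ‖v‖ + ‖∑ i, c i • b i‖ := norm_sub_le _ _
      _ ≤ ‖v‖ + ∑ i : Fin k, 3 * C * ‖v‖ := by
        gcongr
        refine (norm_sum_le _ _).trans (Finset.sum_le_sum fun i _ => ?_)
        rw [← Int.cast_smul_eq_zsmul ℝ, norm_smul, Real.norm_eq_abs]
        exact hci i
      _ = _ := by simp; ring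

lemma exists_goodBasis (k : ℕ) : ∃ C : ℝ, 1 ≤ C ∧ GoodBasis k C := by
  induction k with
  | zero =>
    refine ⟨1, le_rfl, ?_⟩
    intro E _ _ _ L hL hs hk
    have := Module.finrank_zero_iff.mp hk
    exact ⟨Fin.elim0, fun i => i.elim0, fun i => i.elim0,
      fun v _ => ⟨Fin.elim0, Subsingleton.elim _ _, fun i => i.elim0⟩⟩
  | succ k ih =>
    obtain ⟨C, hC1, hC⟩ := ih
    have hC0 : 0 ≤ C := by linarith
    have hkC : 0 ≤ (k : ℝ) * C := by positivity
    refine ⟨1 + 3 * k * C + 3 * C, by nlinarith, ?_⟩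
    intro E _ _ _ L hL hs hk
    have hne : ∃ w ∈ L, w ≠ 0 := by
      by_contra! h
      have : (L : Set E) ⊆ {0} := fun x hx => h x hx
      have h2 := Submodule.span_mono (R := ℝ) this
      rw [hs, Submodule.span_zero_singleton] at h2
      have h3 := finrank_top ℝ E
      rw [le_bot_iff.mp h2, finrank_bot] at h3
      omega
    obtain ⟨w, hw, hw0⟩ := hne
    obtain ⟨a, haL, ha0, hmin⟩ := exists_shortest L hL w hw hw0
    obtain ⟨g, hg1, hg2⟩ := exists_dual_vector ℝ a (norm_ne_zero_iff.mpr ha0)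
    obtain ⟨b, hbL, hb0, -, hb⟩ := good_step k C hC0 hC E L hL hs hk a haL ha0 hmin g.toLinearMap
      (fun x => by
        have := g.le_opNorm x
        rw [hg1, one_mul] at this
        exact this) (by
        change |g a| = _
        rw [hg2]; simp)
    refine ⟨Fin.cons a b, ?_, ?_, ?_⟩
    · intro i; refine Fin.cases ?_ ?_ i <;> simp [haL, hbL]
    · intro i; refine Fin.cases ?_ ?_ i <;> simp [ha0, hb0]
    · intro v hv
      obtain ⟨c0, c, h1, h2, h3⟩ := hb v hv
      have hv0 := norm_nonneg v
      refine ⟨Fin.cons c0 c, ?_, ?_⟩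
      · rw [Fin.sum_univ_succ]; simpa using h1
      · intro i
        refine Fin.cases ?_ ?_ i
        · simp only [Fin.cons_zero]
          refine h2.trans (mul_le_mul_of_nonneg_right ?_ hv0); linarith
        · intro j
          simp only [Fin.cons_succ]
          refine (h3 j).trans (mul_le_mul_of_nonneg_right ?_ hv0); nlinarith
/-- sup norm of an integer vector -/
def nm {d : ℕ} (v : Fin d → ℤ) : ℕ := Finset.univ.sup (fun j => (v j).natAbs)

/-- cast to a real vector -/
def toR {d : ℕ} (v : Fin d → ℤ) : Fin d → ℝ := fun j => (v j : ℝ)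

lemma natAbs_le_nm {d : ℕ} (v : Fin d → ℤ) (j : Fin d) : (v j).natAbs ≤ nm v :=
  Finset.le_sup (f := fun j => (v j).natAbs) (Finset.mem_univ j)

lemma nm_le_iff {d : ℕ} (v : Fin d → ℤ) (n : ℕ) : nm v ≤ n ↔ ∀ j, (v j).natAbs ≤ n := by
  simp [nm]

lemma exists_nm {d : ℕ} (v : Fin (d + 1) → ℤ) : ∃ j, (v j).natAbs = nm v := by
  obtain ⟨j, -, hj⟩ := Finset.exists_mem_eq_sup Finset.univ Finset.univ_nonempty
    (fun j => (v j).natAbs)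
  exact ⟨j, hj.symm⟩

/-- a coordinate in which the sup norm is attained -/
noncomputable def maxIdx {d : ℕ} (v : Fin (d + 1) → ℤ) : Fin (d + 1) :=
  Classical.choose (exists_nm v)

lemma maxIdx_spec {d : ℕ} (v : Fin (d + 1) → ℤ) : (v (maxIdx v)).natAbs = nm v :=
  Classical.choose_spec (exists_nm v)

lemma norm_toR {d : ℕ} (v : Fin d → ℤ) : ‖toR v‖ = nm v := by
  have h : ∀ j, ‖toR v j‖ = ((v j).natAbs : ℝ) := by
    intro j
    rw [toR, Real.norm_eq_abs, Nat.cast_natAbs, Int.cast_abs]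
  apply le_antisymm
  · rw [pi_norm_le_iff_of_nonneg (by positivity)]
    intro j
    rw [h]
    exact_mod_cast natAbs_le_nm v j
  · cases d with
    | zero => simp [nm]
    | succ d =>
      rw [← maxIdx_spec v, ← h]
      exact norm_le_pi_norm _ _

lemma toR_inj {d : ℕ} {v w : Fin d → ℤ} (h : toR v = toR w) : v = w := by
  funext j
  have := congrFun h j
  simpa [toR] using this

lemma nm_pos {d : ℕ} {v : Fin d → ℤ} (h : v ≠ 0) : 1 ≤ nm v := by
  by_contra h1
  apply h
  have h0 : nm v ≤ 0 := by omega
  funext j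
  have := (nm_le_iff v 0).mp h0 j
  simpa using this

lemma finite_nm_le (d n : ℕ) : {v : Fin d → ℤ | nm v ≤ n}.Finite := by
  refine (Set.Finite.pi' (t := fun _ : Fin d => Set.Icc (-(n : ℤ)) n)
    (fun _ => Set.finite_Icc _ _)).subset ?_
  intro v hv j
  have := (nm_le_iff v n).mp hv j
  simp only [Set.mem_Icc]
  omega

lemma struct_basis (k : ℕ) : ∃ C : ℕ, 1 ≤ C ∧ ∀ (d m n : ℕ) (v : Fin m → Fin (d + 1) → ℤ),
    (∀ i, nm (v i) ≤ n) →
    Module.finrank ℝ (Submodule.span ℝ (Set.range fun i => toR (v i))) = k + 1 →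
    ∃ (a : Fin (d + 1) → ℤ) (b : Fin k → Fin (d + 1) → ℤ) (c₀ : Fin m → ℤ)
      (c : Fin k → Fin m → ℤ), 1 ≤ nm a ∧ nm a ≤ C * n ∧
      (∀ l, nm a ≤ nm (b l) ∧ nm (b l) ≤ C * n ∧ 2 * (b l (maxIdx a)).natAbs ≤ nm a) ∧
      (∀ i, (c₀ i).natAbs * nm a ≤ C * n) ∧ (∀ l i, (c l i).natAbs * nm (b l) ≤ C * n) ∧
      ∀ i, v i = c₀ i • a + ∑ l, c l i • b l := by
  obtain ⟨C₀, hC1, hG⟩ := exists_goodBasis k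
  have hC0 : 0 ≤ C₀ := by linarith
  have hkC : 0 ≤ (k : ℝ) * C₀ := by positivity
  obtain ⟨C, hC⟩ := exists_nat_ge (1 + 3 * k * C₀ + 3 * C₀)
  refine ⟨C, by have : (1 : ℝ) ≤ C := by nlinarith
                exact_mod_cast this, ?_⟩
  intro d m n v hvn hrank
  set E := Submodule.span ℝ (Set.range fun i => toR (v i)) with hE
  let Z : AddSubgroup (Fin (d + 1) → ℝ) :=
    { carrier := Set.range toR
      add_mem' := by
        rintro _ _ ⟨x, rfl⟩ ⟨y, rfl⟩
        exact ⟨x + y, by ext; simp [toR]⟩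
      zero_mem' := ⟨0, by ext; simp [toR]⟩
      neg_mem' := by
        rintro _ ⟨x, rfl⟩
        exact ⟨-x, by ext; simp [toR]⟩ }
  let L : AddSubgroup E := Z.comap E.subtype.toAddMonoidHom
  have hLmem : ∀ x : E, x ∈ L ↔ ∃ u, toR u = (x : Fin (d + 1) → ℝ) := fun x => Iff.rfl
  have hvE : ∀ i, toR (v i) ∈ E := fun i => Submodule.subset_span ⟨i, rfl⟩
  have hL : LocFin L := by
    intro R
    refine Set.Finite.of_finite_image (f := fun x : E => (x : Fin (d + 1) → ℝ)) ?_
      (Subtype.val_injective.injOn)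
    refine ((finite_nm_le (d + 1) ⌊R⌋₊).image toR).subset ?_
    rintro _ ⟨x, ⟨hx, hxR⟩, rfl⟩
    obtain ⟨u, hu⟩ := (hLmem x).mp hx
    refine ⟨u, ?_, hu⟩
    have : ‖(x : Fin (d + 1) → ℝ)‖ ≤ R := hxR
    rw [← hu, norm_toR] at this
    exact Nat.le_floor this
  have hvL : ∀ i, (⟨toR (v i), hvE i⟩ : E) ∈ L := fun i => ⟨v i, rfl⟩
  have hspan : Submodule.span ℝ (L : Set E) = ⊤ := by
    rw [eq_top_iff]
    have h1 : Submodule.span ℝ (((↑) : E → Fin (d + 1) → ℝ) ⁻¹' (Set.range fun i => toR (v i))) = ⊤ :=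
      Submodule.span_span_coe_preimage
    rw [← h1]
    apply Submodule.span_mono
    rintro x ⟨i, hi⟩
    exact ⟨v i, hi⟩
  have hne : ∃ i, v i ≠ 0 := by
    by_contra! h
    have : E = ⊥ := by
      rw [hE, Submodule.span_eq_bot]
      rintro _ ⟨i, rfl⟩
      simp only [h i]
      ext; simp [toR]
    rw [this, finrank_bot] at hrank
    omega
  obtain ⟨i₀, hi₀⟩ := hne
  obtain ⟨a', ha'L, ha'0, hmin⟩ := exists_shortest L hL ⟨toR (v i₀), hvE i₀⟩ (hvL i₀) (by
    intro h
    apply hi₀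
    have h2 : toR (v i₀) = 0 := congrArg Subtype.val h
    apply toR_inj
    rw [h2]; ext; simp [toR])
  obtain ⟨a, ha⟩ := (hLmem a').mp ha'L
  have hna : ‖a'‖ = nm a := by rw [← norm_toR, ha]; rfl
  let φ : E →ₗ[ℝ] ℝ := (LinearMap.proj (maxIdx a)).comp E.subtype
  have hφ : ∀ x : E, φ x = (x : Fin (d + 1) → ℝ) (maxIdx a) := fun x => rfl
  obtain ⟨b', hb'L, hb'0, hb'φ, hb'⟩ := good_step k C₀ hC0 hG E L hL hspan hrank a' ha'L ha'0 hmin φ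
    (fun x => by
      rw [hφ]
      exact norm_le_pi_norm (x : Fin (d + 1) → ℝ) _)
    (by
      rw [hφ, ← ha, hna, ← maxIdx_spec a, toR, Nat.cast_natAbs, Int.cast_abs])
  have hbex : ∀ l, ∃ u, toR u = (b' l : Fin (d + 1) → ℝ) := fun l => (hLmem _).mp (hb'L l)
  choose b hb using hbex
  have hnb : ∀ l, ‖b' l‖ = nm (b l) := fun l => by rw [← norm_toR, hb]; rfl
  choose c₀ c hvc hc₀ hc using fun i => hb' _ (hvL i)
  have hnv : ∀ i, ‖(⟨toR (v i), hvE i⟩ : E)‖ ≤ n := fun i => by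
    have : ‖(⟨toR (v i), hvE i⟩ : E)‖ = ‖toR (v i)‖ := rfl
    rw [this, norm_toR]
    exact_mod_cast hvn i
  have hvc' : ∀ i, toR (v i) = c₀ i • toR a + ∑ l, c i l • toR (b l) := by
    intro i
    have := congrArg (Subtype.val) (hvc i)
    simp only [Submodule.coe_add, Submodule.coe_sum] at this
    rw [this, ha]
    congr 1
    exact Finset.sum_congr rfl fun l _ => by rw [hb]; rfl
  have hn0 : (0 : ℝ) ≤ n := by positivity
  have hc₀' : ∀ i, (c₀ i).natAbs * nm a ≤ C * n := by
    intro i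
    have h := hc₀ i
    rw [hna, ← Int.cast_abs, ← Nat.cast_natAbs] at h
    have : ((c₀ i).natAbs : ℝ) * nm a ≤ C * n := by
      refine h.trans ?_
      have := hnv i
      apply mul_le_mul _ this (norm_nonneg _) (by positivity)
      linarith
    exact_mod_cast this
  have hc' : ∀ l i, (c i l).natAbs * nm (b l) ≤ C * n := by
    intro l i
    have h := hc i l
    rw [hnb, ← Int.cast_abs, ← Nat.cast_natAbs] at h
    have : ((c i l).natAbs : ℝ) * nm (b l) ≤ C * n := by
      refine h.trans ?_
      have := hnv i
      apply mul_le_mul _ this (norm_nonneg _) (by positivity)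
      nlinarith
    exact_mod_cast this
  have hminb : ∀ l, nm a ≤ nm (b l) := by
    intro l
    have := hmin (b' l) (hb'L l) (hb'0 l)
    rw [hna, hnb] at this
    exact_mod_cast this
  have ha1 : 1 ≤ nm a := by
    have := norm_pos_iff.mpr ha'0
    rw [hna] at this
    exact_mod_cast this
  refine ⟨a, b, c₀, fun l i => c i l, ha1, ?_, ?_, hc₀', hc', ?_⟩
  · have h1 := hmin ⟨toR (v i₀), hvE i₀⟩ (hvL i₀) (by
      intro h
      apply hi₀
      have h2 : toR (v i₀) = 0 := congrArg Subtype.val h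
      apply toR_inj
      rw [h2]; ext; simp [toR])
    have h2 := h1.trans (hnv i₀)
    rw [hna] at h2
    have h3 : nm a ≤ n := by exact_mod_cast h2
    have h4 : 1 ≤ C := by
      have : (1 : ℝ) ≤ C := by nlinarith
      exact_mod_cast this
    nlinarith
  · intro l
    refine ⟨hminb l, ?_, ?_⟩
    · -- some coefficient is nonzero
      have hex : ∃ i, c i l ≠ 0 := by
        by_contra! h
        have hsub : E ≤ Submodule.span ℝ (Set.range fun l' : Fin k => if l' = l then toR a else toR (b l')) := by
          rw [hE, Submodule.span_le]
          rintro _ ⟨i, rfl⟩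
          simp only [SetLike.mem_coe]
          rw [hvc' i]
          apply Submodule.add_mem
          · rw [← Int.cast_smul_eq_zsmul ℝ]
            exact Submodule.smul_mem _ _ (Submodule.subset_span ⟨l, by simp⟩)
          · apply Submodule.sum_mem
            intro l' _
            by_cases hl : l' = l
            · rw [hl, h i, zero_smul]; exact Submodule.zero_mem _
            · rw [← Int.cast_smul_eq_zsmul ℝ]
              exact Submodule.smul_mem _ _ (Submodule.subset_span ⟨l', by simp [hl]⟩)
        have h1 := Submodule.finrank_mono hsub
        have h2 := finrank_range_le_card (R := ℝ) (fun l' : Fin k => if l' = l then toR a else toR (b l'))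
        rw [Set.finrank, Fintype.card_fin] at h2
        omega
      obtain ⟨i, hi⟩ := hex
      have h1 := hc' l i
      have h2 : 1 ≤ (c i l).natAbs := by omega
      nlinarith
    · have h := hb'φ l
      rw [hφ, ← hb, hna, toR, ← Int.cast_abs, ← Nat.cast_natAbs] at h
      have h2 : (2 : ℝ) * (b l (maxIdx a)).natAbs ≤ nm a := by linarith
      exact_mod_cast h2
  · intro i
    apply toR_inj
    rw [hvc' i]
    ext j
    simp [toR, Finset.sum_apply]

/-- integer vectors of sup norm at most `N` -/
noncomputable def zbox (d N : ℕ) : Finset (Fin d → ℤ) :=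
  Fintype.piFinset (fun _ => Finset.Icc (-(N : ℤ)) N)

lemma mem_zbox {d N : ℕ} {v : Fin d → ℤ} : v ∈ zbox d N ↔ nm v ≤ N := by
  rw [nm_le_iff, zbox, Fintype.mem_piFinset]
  refine forall_congr' fun j => ?_
  rw [Finset.mem_Icc]
  omega

lemma card_zbox (d N : ℕ) : (zbox d N).card = (2 * N + 1) ^ d := by
  rw [zbox, Fintype.card_piFinset]
  simp only [Int.card_Icc, Finset.prod_const, Finset.card_univ, Fintype.card_fin]
  congr 1
  omega

/-- vectors reduced with respect to `a` -/
noncomputable def redSet {d : ℕ} (a : Fin (d + 1) → ℤ) (N : ℕ) : Finset (Fin (d + 1) → ℤ) :=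
  (zbox (d + 1) N).filter (fun b => nm a ≤ nm b ∧ 2 * (b (maxIdx a)).natAbs ≤ nm a)

lemma card_sphere_le (e N s : ℕ) (hs : 1 ≤ s) :
    ((zbox (e + 2) N).filter (fun b => nm b = s)).card ≤ 2 * (e + 2) * 3 ^ (e + 1) * s ^ (e + 1) := by
  classical
  have hsub : (zbox (e + 2) N).filter (fun b => nm b = s) ⊆
      Finset.univ.biUnion (fun j : Fin (e + 2) => Fintype.piFinset (fun i =>
        if i = j then ({(s : ℤ), -(s : ℤ)} : Finset ℤ) else Finset.Icc (-(s : ℤ)) s)) := by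
    intro b hb
    rw [Finset.mem_filter] at hb
    have hbs := hb.2
    rw [Finset.mem_biUnion]
    refine ⟨maxIdx b, Finset.mem_univ _, ?_⟩
    rw [Fintype.mem_piFinset]
    intro i
    split_ifs with h
    · rw [h]
      have := maxIdx_spec b
      simp only [Finset.mem_insert, Finset.mem_singleton]
      omega
    · have := natAbs_le_nm b i
      rw [Finset.mem_Icc]
      omega
  refine (Finset.card_le_card hsub).trans (Finset.card_biUnion_le.trans ?_)
  have hone : ∀ j : Fin (e + 2), (Fintype.piFinset (fun i =>
        if i = j then ({(s : ℤ), -(s : ℤ)} : Finset ℤ) else Finset.Icc (-(s : ℤ)) s)).card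
        ≤ 2 * (3 * s) ^ (e + 1) := by
    intro j
    rw [Fintype.card_piFinset, ← Finset.mul_prod_erase _ _ (Finset.mem_univ j)]
    apply Nat.mul_le_mul
    · simp only [if_true]
      exact Finset.card_le_two
    · refine (Finset.prod_le_pow_card _ _ (3 * s) ?_).trans ?_
      · intro i hi
        rw [if_neg (Finset.ne_of_mem_erase hi), Int.card_Icc]
        omega
      · rw [Finset.card_erase_of_mem (Finset.mem_univ j)]
        simp
  refine (Finset.sum_le_sum fun j _ => hone j).trans ?_
  simp only [Finset.sum_const, Finset.card_univ, Fintype.card_fin, smul_eq_mul]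
  rw [mul_pow]
  apply le_of_eq; ring

lemma card_sphere_red_le (e N s A : ℕ) (j₀ : Fin (e + 2)) (hA : 1 ≤ A) (hs : A ≤ s) :
    ((zbox (e + 2) N).filter (fun b => nm b = s ∧ 2 * (b j₀).natAbs ≤ A)).card
      ≤ 2 * (e + 2) * 3 ^ (e + 1) * (A * s ^ e) := by
  classical
  have hsub : (zbox (e + 2) N).filter (fun b => nm b = s ∧ 2 * (b j₀).natAbs ≤ A) ⊆
      (Finset.univ.erase j₀).biUnion (fun j : Fin (e + 2) => Fintype.piFinset (fun i =>
        if i = j then ({(s : ℤ), -(s : ℤ)} : Finset ℤ) else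
        if i = j₀ then Finset.Icc (-(A : ℤ)) A else Finset.Icc (-(s : ℤ)) s)) := by
    intro b hb
    rw [Finset.mem_filter] at hb
    obtain ⟨-, hbs, hbA⟩ := hb
    rw [Finset.mem_biUnion]
    have hmax := maxIdx_spec b
    refine ⟨maxIdx b, Finset.mem_erase.mpr ⟨?_, Finset.mem_univ _⟩, ?_⟩
    · intro h
      rw [h] at hmax
      omega
    rw [Fintype.mem_piFinset]
    intro i
    split_ifs with h h'
    · rw [h]
      simp only [Finset.mem_insert, Finset.mem_singleton]
      omega
    · rw [h', Finset.mem_Icc]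
      omega
    · have := natAbs_le_nm b i
      rw [Finset.mem_Icc]
      omega
  refine (Finset.card_le_card hsub).trans (Finset.card_biUnion_le.trans ?_)
  have hone : ∀ j ∈ Finset.univ.erase j₀, (Fintype.piFinset (fun i =>
        if i = j then ({(s : ℤ), -(s : ℤ)} : Finset ℤ) else
        if i = j₀ then Finset.Icc (-(A : ℤ)) A else Finset.Icc (-(s : ℤ)) s)).card
        ≤ 2 * ((3 * A) * (3 * s) ^ e) := by
    intro j hj
    have hjj : j₀ ≠ j := (Finset.ne_of_mem_erase hj).symm
    have hj₀ : j₀ ∈ Finset.univ.erase j := Finset.mem_erase.mpr ⟨hjj, Finset.mem_univ _⟩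
    rw [Fintype.card_piFinset, ← Finset.mul_prod_erase _ _ (Finset.mem_univ j),
      ← Finset.mul_prod_erase _ _ hj₀]
    apply Nat.mul_le_mul
    · simp only [if_true]
      exact Finset.card_le_two
    apply Nat.mul_le_mul
    · rw [if_neg hjj, if_pos rfl, Int.card_Icc]
      omega
    · refine (Finset.prod_le_pow_card _ _ (3 * s) ?_).trans ?_
      · intro i hi
        rw [Finset.mem_erase, Finset.mem_erase] at hi
        rw [if_neg hi.2.1, if_neg hi.1, Int.card_Icc]
        omega
      · rw [Finset.card_erase_of_mem hj₀, Finset.card_erase_of_mem (Finset.mem_univ j)]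
        simp
  refine (Finset.sum_le_sum hone).trans ?_
  simp only [Finset.sum_const, smul_eq_mul]
  rw [Finset.card_erase_of_mem (Finset.mem_univ j₀), Finset.card_univ, Fintype.card_fin]
  calc (e + 2 - 1) * (2 * ((3 * A) * (3 * s) ^ e)) ≤ (e + 2) * (2 * ((3 * A) * (3 * s) ^ e)) := by
        gcongr; omega
    _ = _ := by rw [mul_pow]; ring

lemma card_le_sum_basis (k : ℕ) : ∃ C : ℕ, 1 ≤ C ∧ ∀ (d m n : ℕ)
    (F : Finset (Fin m → Fin (d + 1) → ℤ)), (∀ v ∈ F, (∀ i, nm (v i) ≤ n) ∧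
    Module.finrank ℝ (Submodule.span ℝ (Set.range fun i => toR (v i))) = k + 1) →
    (F.card : ℝ) ≤ (3 * C * n : ℝ) ^ (m * (k + 1)) *
      ∑ a ∈ (zbox (d + 1) (C * n)).filter (fun a => 1 ≤ nm a), (1 / (nm a : ℝ) ^ m) *
        (∑ b ∈ redSet a (C * n), 1 / (nm b : ℝ) ^ m) ^ k := by
  classical
  obtain ⟨C, hC1, hC⟩ := struct_basis k
  refine ⟨C, hC1, ?_⟩
  intro d m n F hF
  set M := C * n with hM
  have hsub : F ⊆ ((zbox (d + 1) M).filter (fun a => 1 ≤ nm a)).biUnion (fun a =>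
      (Fintype.piFinset (fun _ : Fin k => redSet a M)).biUnion (fun b =>
        ((zbox m (M / nm a)) ×ˢ (Fintype.piFinset (fun l : Fin k => zbox m (M / nm (b l))))).image
          (fun c => fun i => c.1 i • a + ∑ l, c.2 l i • b l))) := by
    intro v hv
    obtain ⟨h1, h2⟩ := hF v hv
    obtain ⟨a, b, c₀, c, ha1, haM, hb, hc₀, hc, hvc⟩ := hC d m n v h1 h2
    simp only [Finset.mem_biUnion, Finset.mem_image, Finset.mem_product, Fintype.mem_piFinset,
      Finset.mem_filter, mem_zbox, redSet]
    refine ⟨a, ⟨haM, ha1⟩, b, fun l => ⟨(hb l).2.1, (hb l).1, (hb l).2.2⟩, (c₀, c), ⟨?_, ?_⟩, ?_⟩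
    · rw [nm_le_iff]
      intro i
      rw [Nat.le_div_iff_mul_le (by omega)]
      exact hc₀ i
    · intro l
      rw [nm_le_iff]
      intro i
      have := (hb l).1
      rw [Nat.le_div_iff_mul_le (by omega)]
      exact hc l i
    · funext i
      exact (hvc i).symm
  have hkey : ∀ s : ℕ, 1 ≤ s → s ≤ M → ((2 * (M / s) + 1 : ℕ) : ℝ) ≤ 3 * C * n / s := by
    intro s hs hsM
    rw [le_div_iff₀ (by exact_mod_cast hs)]
    have h1 : (M / s) * s ≤ M := Nat.div_mul_le_self M s
    have h2 : (2 * (M / s) + 1) * s ≤ 3 * C * n := by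
      rw [mul_assoc, ← hM]; nlinarith
    exact_mod_cast h2
  have hcard : F.card ≤ ∑ a ∈ (zbox (d + 1) M).filter (fun a => 1 ≤ nm a),
      ∑ b ∈ Fintype.piFinset (fun _ : Fin k => redSet a M),
        (2 * (M / nm a) + 1) ^ m * ∏ l, (2 * (M / nm (b l)) + 1) ^ m := by
    refine (Finset.card_le_card hsub).trans (Finset.card_biUnion_le.trans ?_)
    refine Finset.sum_le_sum fun a _ => Finset.card_biUnion_le.trans ?_
    refine Finset.sum_le_sum fun b _ => Finset.card_image_le.trans ?_
    rw [Finset.card_product, Fintype.card_piFinset]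
    simp only [card_zbox]
    exact le_rfl
  have hcard' : (F.card : ℝ) ≤ ∑ a ∈ (zbox (d + 1) M).filter (fun a => 1 ≤ nm a),
      ∑ b ∈ Fintype.piFinset (fun _ : Fin k => redSet a M),
        ((2 * (M / nm a) + 1 : ℕ) : ℝ) ^ m * ∏ l, ((2 * (M / nm (b l)) + 1 : ℕ) : ℝ) ^ m := by
    exact_mod_cast hcard
  refine hcard'.trans ?_
  rw [Finset.mul_sum]
  refine Finset.sum_le_sum fun a ha => ?_
  rw [Finset.mem_filter, mem_zbox] at ha
  have hb : ∀ b ∈ Fintype.piFinset (fun _ : Fin k => redSet a M),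
      ((2 * (M / nm a) + 1 : ℕ) : ℝ) ^ m * ∏ l, ((2 * (M / nm (b l)) + 1 : ℕ) : ℝ) ^ m ≤
      (3 * C * n / nm a) ^ m * ∏ l, (3 * C * n / nm (b l) : ℝ) ^ m := by
    intro b hb
    simp only [Fintype.mem_piFinset, redSet, Finset.mem_filter, mem_zbox] at hb
    have h1 := hkey (nm a) ha.2 ha.1
    apply mul_le_mul
    · exact pow_le_pow_left₀ (by positivity) h1 _
    · apply Finset.prod_le_prod
      · intros; positivity
      · intro l _
        have hl := hb l
        exact pow_le_pow_left₀ (by positivity) (hkey _ (by omega) hl.1) _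
    · positivity
    · positivity
  refine (Finset.sum_le_sum hb).trans ?_
  rw [← Finset.mul_sum, ← Finset.prod_univ_sum (fun _ : Fin k => redSet a M)
    (fun _ b => (3 * C * n / nm b : ℝ) ^ m)]
  simp only [Finset.prod_const, Finset.card_univ, Fintype.card_fin]
  have h3 : ∑ b ∈ redSet a M, (3 * C * n / nm b : ℝ) ^ m =
      (3 * C * n : ℝ) ^ m * ∑ b ∈ redSet a M, 1 / (nm b : ℝ) ^ m := by
    rw [Finset.mul_sum]
    exact Finset.sum_congr rfl fun b _ => by rw [div_pow]; ring
  rw [h3, mul_pow, div_pow, pow_mul, pow_succ]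
  apply le_of_eq; ring

lemma sum_redSet_le (e M m : ℕ) (a : Fin (e + 2) → ℤ) (ha : 1 ≤ nm a) :
    ∑ b ∈ redSet a M, 1 / (nm b : ℝ) ^ m ≤ ((2 * (e + 2) * 3 ^ (e + 1) : ℕ) : ℝ) *
      ∑ s ∈ Finset.Icc (nm a) M, (nm a : ℝ) * (s : ℝ) ^ e / (s : ℝ) ^ m := by
  classical
  rw [← Finset.sum_fiberwise_of_maps_to (s := redSet a M) (t := Finset.Icc (nm a) M) (g := nm)]
  swap
  · intro b hb
    rw [redSet, Finset.mem_filter, mem_zbox] at hb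
    exact Finset.mem_Icc.mpr ⟨hb.2.1, hb.1⟩
  rw [Finset.mul_sum]
  refine Finset.sum_le_sum fun s hs => ?_
  rw [Finset.mem_Icc] at hs
  have h1 : ∑ b ∈ redSet a M with nm b = s, 1 / (nm b : ℝ) ^ m =
      ((redSet a M).filter (fun b => nm b = s)).card * (1 / (s : ℝ) ^ m) := by
    rw [← nsmul_eq_mul, ← Finset.sum_const]
    refine Finset.sum_congr rfl fun b hb => ?_
    rw [(Finset.mem_filter.mp hb).2]
  have h2 : ((redSet a M).filter (fun b => nm b = s)).card ≤
      2 * (e + 2) * 3 ^ (e + 1) * (nm a * s ^ e) := by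
    refine le_trans (Finset.card_le_card ?_) (card_sphere_red_le e M s (nm a) (maxIdx a) ha hs.1)
    intro b hb
    simp only [redSet, Finset.mem_filter] at hb ⊢
    exact ⟨hb.1.1, hb.2, hb.1.2.2⟩
  have h3 : (((redSet a M).filter (fun b => nm b = s)).card : ℝ) ≤
      ((2 * (e + 2) * 3 ^ (e + 1) : ℕ) : ℝ) * (nm a * s ^ e) := by exact_mod_cast h2
  rw [h1]
  calc _ ≤ ((2 * (e + 2) * 3 ^ (e + 1) : ℕ) : ℝ) * (nm a * s ^ e) * (1 / (s : ℝ) ^ m) := by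
        gcongr
    _ = _ := by ring

lemma sum_box_le (e M m : ℕ) :
    ∑ a ∈ (zbox (e + 2) M).filter (fun a => 1 ≤ nm a), 1 / (nm a : ℝ) ^ m ≤
      ((2 * (e + 2) * 3 ^ (e + 1) : ℕ) : ℝ) *
      ∑ s ∈ Finset.Icc 1 M, (s : ℝ) ^ (e + 1) / (s : ℝ) ^ m := by
  classical
  rw [← Finset.sum_fiberwise_of_maps_to (s := (zbox (e + 2) M).filter (fun a => 1 ≤ nm a))
    (t := Finset.Icc 1 M) (g := nm)]
  swap
  · intro b hb
    rw [Finset.mem_filter, mem_zbox] at hb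
    exact Finset.mem_Icc.mpr ⟨hb.2, hb.1⟩
  rw [Finset.mul_sum]
  refine Finset.sum_le_sum fun s hs => ?_
  rw [Finset.mem_Icc] at hs
  have h1 : ∑ b ∈ (zbox (e + 2) M).filter (fun a => 1 ≤ nm a) with nm b = s, 1 / (nm b : ℝ) ^ m =
      (((zbox (e + 2) M).filter (fun a => 1 ≤ nm a)).filter (fun b => nm b = s)).card
        * (1 / (s : ℝ) ^ m) := by
    rw [← nsmul_eq_mul, ← Finset.sum_const]
    refine Finset.sum_congr rfl fun b hb => ?_
    rw [(Finset.mem_filter.mp hb).2]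
  have h2 : (((zbox (e + 2) M).filter (fun a => 1 ≤ nm a)).filter (fun b => nm b = s)).card ≤
      2 * (e + 2) * 3 ^ (e + 1) * s ^ (e + 1) := by
    refine le_trans (Finset.card_le_card ?_) (card_sphere_le e M s hs.1)
    intro b hb
    simp only [Finset.mem_filter] at hb ⊢
    exact ⟨hb.1.1, hb.2⟩
  have h3 : ((((zbox (e + 2) M).filter (fun a => 1 ≤ nm a)).filter (fun b => nm b = s)).card : ℝ) ≤
      ((2 * (e + 2) * 3 ^ (e + 1) : ℕ) : ℝ) * s ^ (e + 1) := by exact_mod_cast h2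
  rw [h1]
  calc _ ≤ ((2 * (e + 2) * 3 ^ (e + 1) : ℕ) : ℝ) * s ^ (e + 1) * (1 / (s : ℝ) ^ m) := by
        gcongr
    _ = _ := by ring

lemma sum_inv_sq_le (A M : ℕ) (hA : 1 ≤ A) :
    ∑ s ∈ Finset.Icc A M, (1 : ℝ) / (s : ℝ) ^ 2 ≤ (2 : ℝ) / (A : ℝ) := by
  have h := sum_Ioo_inv_sq_le (α := ℝ) (A - 1) (M + 1)
  have h2 : Finset.Ioo (A - 1) (M + 1) = Finset.Icc A M := by
    ext x; simp only [Finset.mem_Ioo, Finset.mem_Icc]; omega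
  rw [h2] at h
  have h3 : ((A - 1 : ℕ) : ℝ) + 1 = A := by
    rw [Nat.cast_sub hA]; simp
  rw [h3] at h
  simpa [one_div] using h

lemma pow_div_pow_le (e m s p : ℕ) (hs : 1 ≤ s) (h : e + p ≤ m) :
    (s : ℝ) ^ e / (s : ℝ) ^ m ≤ 1 / (s : ℝ) ^ p := by
  have hs' : (1 : ℝ) ≤ s := by exact_mod_cast hs
  rw [div_le_div_iff₀ (by positivity) (by positivity), one_mul, ← pow_add]
  exact pow_le_pow_right₀ hs' h

lemma pow_div_pow_le' (e m s p M : ℕ) (hs : 1 ≤ s) (hsM : s ≤ M) (h : e ≤ m + p) :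
    (s : ℝ) ^ e / (s : ℝ) ^ m ≤ (M : ℝ) ^ p := by
  have hs' : (1 : ℝ) ≤ s := by exact_mod_cast hs
  have hs'' : (s : ℝ) ≤ M := by exact_mod_cast hsM
  rw [div_le_iff₀ (by positivity)]
  calc (s : ℝ) ^ e ≤ (s : ℝ) ^ (m + p) := pow_le_pow_right₀ hs' h
    _ = (s : ℝ) ^ p * (s : ℝ) ^ m := by rw [pow_add, mul_comm]
    _ ≤ _ := by gcongr

/-- the logarithmic factor -/
noncomputable def lgf (m d n : ℕ) : ℝ := if m = d then 1 + Real.log n else 1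

lemma one_le_lgf (m d n : ℕ) : 1 ≤ lgf m d n := by
  unfold lgf
  split_ifs
  · have := Real.log_natCast_nonneg n
    linarith
  · exact le_rfl

lemma rank_count (e m k : ℕ) : ∃ B : ℝ, 0 ≤ B ∧ ∀ (n : ℕ), 1 ≤ n →
    ∀ (F : Finset (Fin m → Fin (e + 2) → ℤ)), (∀ v ∈ F, (∀ i, nm (v i) ≤ n) ∧
    Module.finrank ℝ (Submodule.span ℝ (Set.range fun i => toR (v i))) = k + 1) →
    (F.card : ℝ) ≤ B * (n : ℝ) ^ ((k + 1) * max m (e + 2)) * lgf m (e + 2) n := by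
  obtain ⟨C, hC1, hC⟩ := card_le_sum_basis k
  set K : ℝ := ((2 * (e + 2) * 3 ^ (e + 1) : ℕ) : ℝ) with hK
  have hK0 : 0 ≤ K := by positivity
  have hC1' : (1 : ℝ) ≤ C := by exact_mod_cast hC1
  -- generic bound
  have hgen : ∀ (n : ℕ) (t U : ℝ), 0 ≤ t →
      (∀ A, 1 ≤ A → ∑ s ∈ Finset.Icc A (C * n), (A : ℝ) * (s : ℝ) ^ e / (s : ℝ) ^ m ≤ t) →
      (∑ s ∈ Finset.Icc 1 (C * n), (s : ℝ) ^ (e + 1) / (s : ℝ) ^ m ≤ U) →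
      ∀ (F : Finset (Fin m → Fin (e + 2) → ℤ)), (∀ v ∈ F, (∀ i, nm (v i) ≤ n) ∧
      Module.finrank ℝ (Submodule.span ℝ (Set.range fun i => toR (v i))) = k + 1) →
      (F.card : ℝ) ≤ (3 * C * n : ℝ) ^ (m * (k + 1)) * ((K * U) * (K * t) ^ k) := by
    intro n t U ht h1 h2 F hF
    refine (hC (e + 1) m n F hF).trans ?_
    gcongr
    calc _ ≤ ∑ a ∈ (zbox (e + 2) (C * n)).filter (fun a => 1 ≤ nm a), (1 / (nm a : ℝ) ^ m) *
          (K * t) ^ k := by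
          refine Finset.sum_le_sum fun a ha => ?_
          have ha1 := (Finset.mem_filter.mp ha).2
          gcongr
          refine (sum_redSet_le e (C * n) m a ha1).trans ?_
          gcongr
          exact h1 _ ha1
      _ = (∑ a ∈ (zbox (e + 2) (C * n)).filter (fun a => 1 ≤ nm a), (1 / (nm a : ℝ) ^ m)) *
          (K * t) ^ k := by rw [Finset.sum_mul]
      _ ≤ (K * U) * (K * t) ^ k := by
          gcongr
          refine (sum_box_le e (C * n) m).trans ?_
          gcongr
  have ht2 : e + 2 ≤ m → ∀ n A : ℕ, 1 ≤ A →
      ∑ s ∈ Finset.Icc A (C * n), (A : ℝ) * (s : ℝ) ^ e / (s : ℝ) ^ m ≤ (2 : ℝ) := by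
    intro hm n A hA
    have hA' : (0 : ℝ) < A := by exact_mod_cast hA
    calc _ ≤ ∑ s ∈ Finset.Icc A (C * n), (A : ℝ) * ((1 : ℝ) / (s : ℝ) ^ 2) := by
          refine Finset.sum_le_sum fun s hs => ?_
          rw [Finset.mem_Icc] at hs
          rw [mul_div_assoc]
          exact mul_le_mul_of_nonneg_left (pow_div_pow_le e m s 2 (by omega) hm) hA'.le
      _ = (A : ℝ) * ∑ s ∈ Finset.Icc A (C * n), ((1 : ℝ) / (s : ℝ) ^ 2) := by rw [Finset.mul_sum]
      _ ≤ (A : ℝ) * (2 / A) := by gcongr; exact sum_inv_sq_le A _ hA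
      _ = 2 := by field_simp
  rcases lt_trichotomy m (e + 2) with hm | hm | hm
  · -- m < d
    obtain ⟨p, hp⟩ : ∃ p, e + 2 = m + (p + 1) := ⟨e + 1 - m, by omega⟩
    refine ⟨(3 * C) ^ (m * (k + 1)) * (K * (C : ℝ) ^ (p + 1)) ^ (k + 1), by positivity, ?_⟩
    intro n hn F hF
    have hlg : lgf m (e + 2) n = 1 := by rw [lgf, if_neg (by omega)]
    rw [hlg, mul_one, max_eq_right (by omega)]
    have hU : ∑ s ∈ Finset.Icc 1 (C * n), (s : ℝ) ^ (e + 1) / (s : ℝ) ^ m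
        ≤ ((C * n : ℕ) : ℝ) ^ (p + 1) := by
      calc _ ≤ ∑ s ∈ Finset.Icc 1 (C * n), ((C * n : ℕ) : ℝ) ^ p := by
            refine Finset.sum_le_sum fun s hs => ?_
            rw [Finset.mem_Icc] at hs
            exact pow_div_pow_le' (e + 1) m s p _ hs.1 hs.2 (by omega)
        _ = _ := by rw [Finset.sum_const, Nat.card_Icc, nsmul_eq_mul, pow_succ]; simp [mul_comm]
    have ht : ∀ A : ℕ, 1 ≤ A → ∑ s ∈ Finset.Icc A (C * n), (A : ℝ) * (s : ℝ) ^ e / (s : ℝ) ^ m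
        ≤ ((C * n : ℕ) : ℝ) ^ (p + 1) := by
      intro A hA
      refine le_trans ?_ hU
      calc _ ≤ ∑ s ∈ Finset.Icc A (C * n), (s : ℝ) ^ (e + 1) / (s : ℝ) ^ m := by
            refine Finset.sum_le_sum fun s hs => ?_
            rw [Finset.mem_Icc] at hs
            have : (A : ℝ) ≤ s := by exact_mod_cast hs.1
            rw [pow_succ']
            gcongr
        _ ≤ _ := by
            apply Finset.sum_le_sum_of_subset_of_nonneg
            · exact Finset.Icc_subset_Icc_left hA
            · intros; positivity
    refine (hgen n _ _ (by positivity) ht hU F hF).trans (le_of_eq ?_)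
    rw [hp]
    push_cast
    simp only [mul_pow, pow_mul, pow_add, pow_one]
    ring
  · -- m = d
    refine ⟨(3 * C) ^ (m * (k + 1)) * ((K * (1 + Real.log C)) * (K * 2) ^ k), ?_, ?_⟩
    · have := Real.log_nonneg hC1'
      positivity
    intro n hn F hF
    have hn' : (1 : ℝ) ≤ n := by exact_mod_cast hn
    have hlg : lgf m (e + 2) n = 1 + Real.log n := by rw [lgf, if_pos hm]
    rw [hlg, max_eq_left (by omega)]
    have hlC := Real.log_nonneg hC1'
    have hln := Real.log_nonneg hn'
    have hU : ∑ s ∈ Finset.Icc 1 (C * n), (s : ℝ) ^ (e + 1) / (s : ℝ) ^ m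
        ≤ (1 + Real.log C) * (1 + Real.log n) := by
      calc _ ≤ ∑ s ∈ Finset.Icc 1 (C * n), ((s : ℝ))⁻¹ := by
            refine Finset.sum_le_sum fun s hs => ?_
            rw [Finset.mem_Icc] at hs
            have := pow_div_pow_le (e + 1) m s 1 hs.1 (by omega)
            simpa using this
        _ = ((harmonic (C * n) : ℚ) : ℝ) := by
            rw [harmonic_eq_sum_Icc]; push_cast; rfl
        _ ≤ 1 + Real.log ((C * n : ℕ) : ℝ) := harmonic_le_one_add_log _
        _ = 1 + (Real.log C + Real.log n) := by
            push_cast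
            rw [Real.log_mul (by positivity) (by positivity)]
        _ ≤ _ := by nlinarith
    refine (hgen n 2 _ (by positivity) (ht2 hm.ge n) hU F hF).trans (le_of_eq ?_)
    rw [mul_pow (3 * (C : ℝ)) (n : ℝ), mul_comm m (k + 1)]
    ring
  · -- m > d
    refine ⟨(3 * C) ^ (m * (k + 1)) * ((K * 2) * (K * 2) ^ k), by positivity, ?_⟩
    intro n hn F hF
    have hlg : lgf m (e + 2) n = 1 := by rw [lgf, if_neg (by omega)]
    rw [hlg, mul_one, max_eq_left (by omega)]
    have hU : ∑ s ∈ Finset.Icc 1 (C * n), (s : ℝ) ^ (e + 1) / (s : ℝ) ^ m ≤ (2 : ℝ) := by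
      calc _ ≤ ∑ s ∈ Finset.Icc 1 (C * n), ((1 : ℝ) / (s : ℝ) ^ 2) := by
            refine Finset.sum_le_sum fun s hs => ?_
            rw [Finset.mem_Icc] at hs
            exact pow_div_pow_le (e + 1) m s 2 hs.1 (by omega)
        _ ≤ (2 : ℝ) / ((1 : ℕ) : ℝ) := sum_inv_sq_le 1 _ le_rfl
        _ = 2 := by simp
    refine (hgen n 2 2 (by positivity) (ht2 hm.le n) hU F hF).trans (le_of_eq ?_)
    rw [mul_pow (3 * (C : ℝ)) (n : ℝ), mul_comm m (k + 1)]
    ring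

lemma card_fun_zero {α : Type} [Fintype α] [DecidableEq α] (q : ℕ) (e : Finset α) :
    ((Finset.univ.filter (fun χ : α → Fin (q + 1) => ∀ x ∈ e, χ x = 0)).card : ℝ)
      = ((q + 1 : ℕ) : ℝ) ^ (Fintype.card α) / ((q + 1 : ℕ) : ℝ) ^ e.card := by
  have h1 : Finset.univ.filter (fun χ : α → Fin (q + 1) => ∀ x ∈ e, χ x = 0) =
      Fintype.piFinset (fun x => if x ∈ e then {0} else Finset.univ) := by
    ext χ
    simp only [Finset.mem_filter, Finset.mem_univ, true_and, Fintype.mem_piFinset]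
    refine forall_congr' fun x => ?_
    split_ifs with h <;> simp [h]
  rw [h1, Fintype.card_piFinset, eq_div_iff (by positivity)]
  have h2 : ∀ x, ((if x ∈ e then ({0} : Finset (Fin (q + 1))) else Finset.univ).card)
      * (if x ∈ e then q + 1 else 1) = q + 1 := by
    intro x; split_ifs <;> simp
  have h3 : (∏ x : α, (if x ∈ e then q + 1 else 1)) = (q + 1) ^ e.card := by
    rw [Finset.prod_ite_mem, Finset.univ_inter, Finset.prod_const]
  have h4 : (∏ x : α, ((if x ∈ e then ({0} : Finset (Fin (q + 1))) else Finset.univ).card))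
      * (q + 1) ^ e.card = (q + 1) ^ Fintype.card α := by
    rw [← h3, ← Finset.prod_mul_distrib, Finset.prod_congr rfl fun x _ => h2 x, Finset.prod_const,
      Finset.card_univ]
  exact_mod_cast h4

lemma deletion {α : Type} [Fintype α] [DecidableEq α] (F : Finset (Finset α)) (r q : ℕ)
    (hr : 1 ≤ r) (hq : 1 ≤ q) (hF : ∀ e ∈ F, e.card = r) :
    ∃ S : Finset α, (∀ e ∈ F, ¬ e ⊆ S) ∧
      (Fintype.card α : ℝ) / q - (F.card : ℝ) / (q : ℝ) ^ r ≤ S.card := by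
  obtain ⟨p, rfl⟩ : ∃ p, q = p + 1 := ⟨q - 1, by omega⟩
  set Q : ℝ := ((p + 1 : ℕ) : ℝ) with hQ
  have hQ0 : 0 < Q := by positivity
  set N := Fintype.card α
  let T : (α → Fin (p + 1)) → Finset α := fun χ => Finset.univ.filter (fun x => χ x = 0)
  let D : (α → Fin (p + 1)) → Finset (Finset α) := fun χ => F.filter (fun e => e ⊆ T χ)
  have hsumT : ∑ χ, ((T χ).card : ℝ) = N * (Q ^ N / Q) := by
    have h1 : ∑ χ, (T χ).card = ∑ x : α,
        (Finset.univ.filter (fun χ : α → Fin (p + 1) => χ x = 0)).card := by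
      simp only [T, Finset.card_filter]
      exact Finset.sum_comm
    have h2 : ∀ x : α, ((Finset.univ.filter (fun χ : α → Fin (p + 1) => χ x = 0)).card : ℝ)
        = Q ^ N / Q := by
      intro x
      have := card_fun_zero p ({x} : Finset α)
      simpa [hQ, N] using this
    have h3 : ∑ χ, ((T χ).card : ℝ) = ∑ x : α,
        ((Finset.univ.filter (fun χ : α → Fin (p + 1) => χ x = 0)).card : ℝ) := by
      exact_mod_cast h1
    rw [h3, Finset.sum_congr rfl fun x _ => h2 x, Finset.sum_const, nsmul_eq_mul, Finset.card_univ]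
  have hsumD : ∑ χ, ((D χ).card : ℝ) = F.card * (Q ^ N / Q ^ r) := by
    have h1 : ∑ χ, (D χ).card = ∑ e ∈ F,
        (Finset.univ.filter (fun χ : α → Fin (p + 1) => ∀ x ∈ e, χ x = 0)).card := by
      simp only [D, Finset.card_filter]
      rw [Finset.sum_comm]
      refine Finset.sum_congr rfl fun e _ => Finset.sum_congr rfl fun χ _ => ?_
      simp [T, Finset.subset_iff]
    have h3 : ∑ χ, ((D χ).card : ℝ) = ∑ e ∈ F,
        ((Finset.univ.filter (fun χ : α → Fin (p + 1) => ∀ x ∈ e, χ x = 0)).card : ℝ) := by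
      exact_mod_cast h1
    rw [h3, ← nsmul_eq_mul, ← Finset.sum_const]
    refine Finset.sum_congr rfl fun e he => ?_
    rw [card_fun_zero, hF e he]
  have hex : ∃ χ ∈ (Finset.univ : Finset (α → Fin (p + 1))),
      (N : ℝ) / Q - (F.card : ℝ) / Q ^ r ≤ ((T χ).card : ℝ) - (D χ).card := by
    apply Finset.exists_le_of_sum_le Finset.univ_nonempty
    rw [Finset.sum_sub_distrib (f := fun χ => ((T χ).card : ℝ)), hsumT, hsumD, Finset.sum_const,
      nsmul_eq_mul, Finset.card_univ]
    simp only [Fintype.card_fun, Fintype.card_fin]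
    rw [Nat.cast_pow, ← hQ]
    apply le_of_eq
    ring
  obtain ⟨χ, -, hχ⟩ := hex
  have hpick : ∀ e : {e // e ∈ D χ}, ∃ x, x ∈ e.1 := by
    intro e
    have he : e.1 ∈ F := (Finset.mem_filter.mp e.2).1
    have : 0 < e.1.card := by rw [hF e.1 he]; omega
    obtain ⟨x, hx⟩ := Finset.card_pos.mp this
    exact ⟨x, hx⟩
  choose pick hpk using hpick
  set R := (D χ).attach.image pick with hR
  have hRcard : R.card ≤ (D χ).card := by
    refine Finset.card_image_le.trans ?_
    rw [Finset.card_attach]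
  refine ⟨T χ \ R, ?_, ?_⟩
  · intro e he hsub
    have heD : e ∈ D χ := Finset.mem_filter.mpr ⟨he, hsub.trans Finset.sdiff_subset⟩
    have h1 := hsub (hpk ⟨e, heD⟩)
    rw [Finset.mem_sdiff] at h1
    exact h1.2 (Finset.mem_image.mpr ⟨⟨e, heD⟩, Finset.mem_attach _ _, rfl⟩)
  · have h1 := Finset.le_card_sdiff R (T χ)
    have h2 : (T χ).card ≤ (T χ \ R).card + (D χ).card := by omega
    have h3 : ((T χ).card : ℝ) ≤ (T χ \ R).card + (D χ).card := by exact_mod_cast h2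
    linarith

/-- grid points as real points -/
noncomputable def rpt {d n : ℕ} (x : Fin d → Fin n) : EuclideanSpace ℝ (Fin d) :=
  WithLp.toLp 2 (fun j => ((x j : ℕ) : ℝ) + 1)

/-- grid points as integer points -/
def zpt {d n : ℕ} (x : Fin d → Fin n) : Fin d → ℤ := fun j => ((x j : ℕ) : ℤ)

lemma rpt_inj {d n : ℕ} : Function.Injective (rpt : (Fin d → Fin n) → _) := by
  intro x y h
  funext j
  have := congrArg (fun z : EuclideanSpace ℝ (Fin d) => z j) h
  simp only [rpt, add_left_inj, Nat.cast_inj] at this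
  exact Fin.ext this

lemma zpt_inj {d n : ℕ} : Function.Injective (zpt : (Fin d → Fin n) → _) := by
  intro x y h
  funext j
  have := congrFun h j
  simp only [zpt, Nat.cast_inj] at this
  exact Fin.ext this

lemma rpt_mem_grid {d n : ℕ} (x : Fin d → Fin n) : rpt x ∈ grid d n := by
  intro i
  refine ⟨(x i : ℕ) + 1, by omega, by have := (x i).2; omega, ?_⟩
  simp [rpt]

lemma count_tuples (e m k : ℕ) : ∃ B : ℝ, 0 ≤ B ∧ ∀ (n : ℕ), 1 ≤ n →
    ∀ (G : Finset (Fin m → Fin (e + 2) → ℤ)), (∀ v ∈ G, (∀ i, nm (v i) ≤ n) ∧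
    1 ≤ Module.finrank ℝ (Submodule.span ℝ (Set.range fun i => toR (v i))) ∧
    Module.finrank ℝ (Submodule.span ℝ (Set.range fun i => toR (v i))) ≤ k) →
    (G.card : ℝ) ≤ B * (n : ℝ) ^ (k * max m (e + 2)) * lgf m (e + 2) n := by
  classical
  choose B hB0 hB using fun j => rank_count e m j
  refine ⟨∑ j ∈ Finset.range k, B j, Finset.sum_nonneg fun j _ => hB0 j, ?_⟩
  intro n hn G hG
  have hn' : (1 : ℝ) ≤ n := by exact_mod_cast hn
  have hsub : G ⊆ (Finset.range k).biUnion (fun j => G.filter (fun v =>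
      Module.finrank ℝ (Submodule.span ℝ (Set.range fun i => toR (v i))) = j + 1)) := by
    intro v hv
    obtain ⟨-, h1, h2⟩ := hG v hv
    rw [Finset.mem_biUnion]
    refine ⟨Module.finrank ℝ (Submodule.span ℝ (Set.range fun i => toR (v i))) - 1, ?_, ?_⟩
    · rw [Finset.mem_range]; omega
    · rw [Finset.mem_filter]
      exact ⟨hv, by omega⟩
  have h1 := (Finset.card_le_card hsub).trans Finset.card_biUnion_le
  have h2 : (G.card : ℝ) ≤ ∑ j ∈ Finset.range k, ((G.filter (fun v =>
      Module.finrank ℝ (Submodule.span ℝ (Set.range fun i => toR (v i))) = j + 1)).card : ℝ) := by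
    exact_mod_cast h1
  refine h2.trans ?_
  rw [Finset.sum_mul, Finset.sum_mul]
  refine Finset.sum_le_sum fun j hj => ?_
  rw [Finset.mem_range] at hj
  refine (hB j n hn _ ?_).trans ?_
  · intro v hv
    rw [Finset.mem_filter] at hv
    exact ⟨(hG v hv.1).1, hv.2⟩
  · have := one_le_lgf m (e + 2) n
    have hb := hB0 j
    have hp : (n : ℝ) ^ ((j + 1) * max m (e + 2)) ≤ (n : ℝ) ^ (k * max m (e + 2)) :=
      pow_le_pow_right₀ hn' (Nat.mul_le_mul_right _ hj)
    gcongr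

lemma count_bad (e m k : ℕ) (hm : 1 ≤ m) : ∃ B : ℝ, 0 ≤ B ∧ ∀ (n : ℕ), 1 ≤ n →
    ∀ (F : Finset (Finset (Fin (e + 2) → Fin n))), (∀ s ∈ F, s.card = m + 1 ∧
      Module.finrank ℝ (vectorSpan ℝ (rpt '' (s : Set (Fin (e + 2) → Fin n)))) ≤ k) →
    (F.card : ℝ) ≤ (n : ℝ) ^ (e + 2) * (B * (n : ℝ) ^ (k * max m (e + 2)) * lgf m (e + 2) n) := by
  classical
  obtain ⟨B, hB0, hB⟩ := count_tuples e m k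
  refine ⟨B, hB0, ?_⟩
  intro n hn F hF
  have hσ : ∀ s : Finset (Fin (e + 2) → Fin n), ∃ σ : Fin (m + 1) → (Fin (e + 2) → Fin n), s ∈ F →
      Function.Injective σ ∧ Finset.univ.image σ = s := by
    intro s
    by_cases hs : s ∈ F
    · have φ := (s.equivFinOfCardEq (hF s hs).1).symm
      refine ⟨fun i => (φ i).1, fun _ => ⟨fun i j h => φ.injective (Subtype.ext h), ?_⟩⟩
      ext x
      simp only [Finset.mem_image, Finset.mem_univ, true_and]
      constructor
      · rintro ⟨i, rfl⟩
        exact (φ i).2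
      · intro hx
        exact ⟨φ.symm ⟨x, hx⟩, by simp⟩
    · exact ⟨fun _ _ => ⟨0, hn⟩, fun h => absurd h hs⟩
  choose σ hσ using hσ
  let vv : Finset (Fin (e + 2) → Fin n) → Fin m → Fin (e + 2) → ℤ :=
    fun s i => zpt (σ s i.succ) - zpt (σ s 0)
  let Φ : Finset (Fin (e + 2) → Fin n) → (Fin (e + 2) → Fin n) × (Fin m → Fin (e + 2) → ℤ) :=
    fun s => (σ s 0, vv s)
  have hinj : Set.InjOn Φ F := by
    intro s hs t ht h
    have h0 : σ s 0 = σ t 0 := congrArg Prod.fst h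
    have h1 : vv s = vv t := congrArg Prod.snd h
    have h2 : σ s = σ t := by
      funext i
      refine Fin.cases h0 (fun j => ?_) i
      have := congrFun h1 j
      simp only [vv, h0, sub_left_inj] at this
      exact zpt_inj this
    rw [← (hσ s hs).2, ← (hσ t ht).2, h2]
  have hmap : ∀ s ∈ F, Φ s ∈ (Finset.univ : Finset (Fin (e + 2) → Fin n)) ×ˢ (F.image vv) := by
    intro s hs
    exact Finset.mem_product.mpr ⟨Finset.mem_univ _, Finset.mem_image_of_mem _ hs⟩
  have hcard := Finset.card_le_card_of_injOn Φ hmap hinj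
  rw [Finset.card_product, Finset.card_univ, Fintype.card_fun, Fintype.card_fin, Fintype.card_fin]
    at hcard
  have hcard' : (F.card : ℝ) ≤ (n : ℝ) ^ (e + 2) * ((F.image vv).card : ℝ) := by exact_mod_cast hcard
  refine hcard'.trans ?_
  gcongr
  apply hB n hn
  intro v hv
  obtain ⟨s, hs, rfl⟩ := Finset.mem_image.mp hv
  obtain ⟨hinjσ, himg⟩ := hσ s hs
  refine ⟨?_, ?_, ?_⟩
  · intro i
    rw [nm_le_iff]
    intro j
    have h1 := (σ s i.succ j).2
    have h2 := (σ s 0 j).2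
    simp only [vv, zpt, Pi.sub_apply]
    omega
  · rw [Nat.one_le_iff_ne_zero]
    intro h0
    rw [Submodule.finrank_eq_zero, Submodule.span_eq_bot] at h0
    have h1 := h0 _ ⟨⟨0, hm⟩, rfl⟩
    have h2 : vv s ⟨0, hm⟩ = 0 := by
      apply toR_inj
      refine Eq.trans h1 ?_
      ext; simp [toR]
    have h3 : zpt (σ s (Fin.succ ⟨0, hm⟩)) = zpt (σ s 0) := sub_eq_zero.mp h2
    have h4 := hinjσ (zpt_inj h3)
    exact Fin.succ_ne_zero _ h4
  · refine le_trans ?_ (hF s hs).2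
    set V := vectorSpan ℝ (rpt '' (s : Set (Fin (e + 2) → Fin n)))
    let Lm : EuclideanSpace ℝ (Fin (e + 2)) →ₗ[ℝ] (Fin (e + 2) → ℝ) :=
      (WithLp.linearEquiv 2 ℝ (Fin (e + 2) → ℝ)).toLinearMap
    have hle : Submodule.span ℝ (Set.range fun i => toR (vv s i)) ≤ V.map Lm := by
      rw [Submodule.span_le]
      rintro _ ⟨i, rfl⟩
      have hmem : ∀ i, σ s i ∈ (s : Set (Fin (e + 2) → Fin n)) := by
        intro i
        have : σ s i ∈ Finset.univ.image (σ s) := Finset.mem_image_of_mem _ (Finset.mem_univ i)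
        rw [himg] at this
        exact this
      refine ⟨rpt (σ s i.succ) -ᵥ rpt (σ s 0), ?_, ?_⟩
      · exact vsub_mem_vectorSpan ℝ ⟨_, hmem _, rfl⟩ ⟨_, hmem _, rfl⟩
      · ext j
        simp [Lm, rpt, vv, toR, zpt]
    exact (Submodule.finrank_mono hle).trans (Submodule.finrank_map_le Lm V)

lemma exists_set (e m k : ℕ) (hm : 1 ≤ m) : ∃ c : ℝ, 0 < c ∧ ∀ n : ℕ, 1 ≤ n →
      ∃ S : Set (EuclideanSpace ℝ (Fin (e + 2))), S ⊆ grid (e + 2) n ∧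
        c * ((n : ℝ) ^ (e + 2) / ((n : ℝ) ^ ((k * max m (e + 2) : ℕ) / (m : ℝ)) *
          lgf m (e + 2) n ^ (1 / (m : ℝ)))) ≤ S.ncard ∧
        ∀ A : AffineSubspace ℝ (EuclideanSpace ℝ (Fin (e + 2))),
          Module.finrank ℝ A.direction ≤ k →
            (S ∩ (A : Set (EuclideanSpace ℝ (Fin (e + 2))))).ncard < m + 1 := by
  classical
  obtain ⟨B, hB0, hB⟩ := count_bad e m k hm
  have hm0 : (m : ℝ) ≠ 0 := by positivity
  set B' := B + 1 with hB'
  have hB'0 : 0 < B' := by linarith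
  refine ⟨1 / (4 * (2 * B') ^ (1 / (m : ℝ))), by positivity, ?_⟩
  intro n hn
  have hn' : (1 : ℝ) ≤ n := by exact_mod_cast hn
  set lg := lgf m (e + 2) n with hlg
  have hlg1 : 1 ≤ lg := one_le_lgf _ _ _
  set P := k * max m (e + 2) with hP
  set Y : ℝ := 2 * B' * (n : ℝ) ^ P * lg with hY
  have hnP : (1 : ℝ) ≤ (n : ℝ) ^ P := one_le_pow₀ hn'
  have hY1 : 1 ≤ Y := by
    have : 1 ≤ (n : ℝ) ^ P * lg := one_le_mul_of_one_le_of_one_le hnP hlg1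
    rw [hY, mul_assoc]; nlinarith
  set Z := Y ^ (1 / (m : ℝ)) with hZ
  have hZ1 : 1 ≤ Z := Real.one_le_rpow hY1 (by positivity)
  have hZm : Z ^ m = Y := by
    rw [hZ, one_div, Real.rpow_inv_natCast_pow (by linarith) (by omega)]
  have hZeq : Z = (2 * B') ^ (1 / (m : ℝ)) * ((n : ℝ) ^ ((P : ℕ) / (m : ℝ)) * lg ^ (1 / (m : ℝ))) := by
    rw [hZ, hY, Real.mul_rpow (by positivity) (by positivity),
      Real.mul_rpow (by positivity) (by positivity), ← Real.rpow_natCast, ← Real.rpow_mul (by positivity)]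
    rw [mul_assoc, mul_one_div]
  set q := ⌈Z⌉₊ with hq
  have hqZ : Z ≤ q := Nat.le_ceil Z
  have hq1 : 1 ≤ q := by
    have : (1 : ℝ) ≤ q := hZ1.trans hqZ
    exact_mod_cast this
  have hq2 : (q : ℝ) ≤ 2 * Z := by
    have := Nat.ceil_lt_add_one (show 0 ≤ Z by linarith)
    linarith
  have hqm : Y ≤ (q : ℝ) ^ m := by
    rw [← hZm]; exact pow_le_pow_left₀ (by linarith) hqZ m
  let F : Finset (Finset (Fin (e + 2) → Fin n)) := Finset.univ.filter (fun s => s.card = m + 1 ∧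
      Module.finrank ℝ (vectorSpan ℝ (rpt '' (s : Set (Fin (e + 2) → Fin n)))) ≤ k)
  have hF : ∀ s ∈ F, s.card = m + 1 ∧
      Module.finrank ℝ (vectorSpan ℝ (rpt '' (s : Set (Fin (e + 2) → Fin n)))) ≤ k :=
    fun s hs => (Finset.mem_filter.mp hs).2
  have hFc := hB n hn F hF
  obtain ⟨T, hT1, hT2⟩ := deletion F (m + 1) q (by omega) hq1 (fun s hs => (hF s hs).1)
  rw [Fintype.card_fun, Fintype.card_fin, Fintype.card_fin] at hT2
  have hq0 : (0 : ℝ) < q := by exact_mod_cast hq1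
  refine ⟨rpt '' (T : Set (Fin (e + 2) → Fin n)), ?_, ?_, ?_⟩
  · rintro _ ⟨x, -, rfl⟩
    exact rpt_mem_grid x
  · rw [Set.ncard_image_of_injective _ rpt_inj, Set.ncard_coe_finset]
    refine le_trans ?_ hT2
    push_cast
    have hFY : (F.card : ℝ) ≤ (n : ℝ) ^ (e + 2) * (Y / 2) := by
      refine hFc.trans ?_
      gcongr
      rw [hY]
      have : 0 ≤ (n : ℝ) ^ P * lg := by positivity
      nlinarith
    have hF2 : (F.card : ℝ) / (q : ℝ) ^ (m + 1) ≤ (n : ℝ) ^ (e + 2) / (2 * q) := by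
      rw [div_le_div_iff₀ (by positivity) (by positivity)]
      calc (F.card : ℝ) * (2 * q) ≤ ((n : ℝ) ^ (e + 2) * (Y / 2)) * (2 * q) := by gcongr
        _ = (n : ℝ) ^ (e + 2) * (Y * q) := by ring
        _ ≤ (n : ℝ) ^ (e + 2) * ((q : ℝ) ^ m * q) := by gcongr
        _ = _ := by ring
    have hmain : (n : ℝ) ^ (e + 2) / (4 * Z) ≤ (n : ℝ) ^ (e + 2) / (2 * q) := by
      apply div_le_div_of_nonneg_left (by positivity) (by positivity)
      linarith
    have hhalf : (n : ℝ) ^ (e + 2) / q - (n : ℝ) ^ (e + 2) / (2 * q) = (n : ℝ) ^ (e + 2) / (2 * q) := by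
      field_simp; ring
    refine le_trans (le_of_eq ?_) (hmain.trans (by linarith : _ ≤ _))
    rw [hZeq]
    rw [div_mul_div_comm, one_mul]
    rw [mul_assoc 4]
  · intro A hA
    by_contra hcon
    rw [not_lt] at hcon
    have heq : rpt '' (T : Set (Fin (e + 2) → Fin n)) ∩ (A : Set (EuclideanSpace ℝ (Fin (e + 2)))) =
        rpt '' ((T.filter (fun x => rpt x ∈ A) : Finset _) : Set (Fin (e + 2) → Fin n)) := by
      ext y
      simp only [Set.mem_inter_iff, Set.mem_image, Finset.coe_filter, Set.mem_ofPred_eq,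
        SetLike.mem_coe]
      constructor
      · rintro ⟨⟨x, hx, rfl⟩, hy⟩
        exact ⟨x, ⟨hx, hy⟩, rfl⟩
      · rintro ⟨x, ⟨hx, hy⟩, rfl⟩
        exact ⟨⟨x, hx, rfl⟩, hy⟩
    rw [heq, Set.ncard_image_of_injective _ rpt_inj, Set.ncard_coe_finset] at hcon
    obtain ⟨s, hs, hsc⟩ := Finset.exists_subset_card_eq hcon
    refine hT1 s ?_ (hs.trans (Finset.filter_subset _ _))
    refine Finset.mem_filter.mpr ⟨Finset.mem_univ _, hsc, le_trans ?_ hA⟩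
    apply Submodule.finrank_mono
    rw [AffineSubspace.direction_eq_vectorSpan]
    apply vectorSpan_mono
    rintro _ ⟨x, hx, rfl⟩
    exact (Finset.mem_filter.mp (hs hx)).2

theorem affine_evasive_lower_bound (d k r : ℕ) (hd : 0 < d) (hk : 0 < k) (hr : 0 < r)
    (hkd : k < d) (hrk : k + 2 ≤ r) :
    ∃ c : ℝ, 0 < c ∧ ∃ N : ℕ, ∀ n ≥ N,
      ∃ S : Set (EuclideanSpace ℝ (Fin d)),
        S ⊆ grid d n ∧ c * fdkr d k r n ≤ S.ncard ∧
        ∀ A : AffineSubspace ℝ (EuclideanSpace ℝ (Fin d)),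
          Module.finrank ℝ A.direction ≤ k → (S ∩ (A : Set (EuclideanSpace ℝ (Fin d)))).ncard < r := by
  obtain ⟨e, rfl⟩ : ∃ e, d = e + 2 := ⟨d - 2, by omega⟩
  obtain ⟨m, rfl⟩ : ∃ m, r = m + 1 := ⟨r - 1, by omega⟩
  obtain ⟨c, hc, hS⟩ := exists_set e m k (by omega)
  refine ⟨c / 2, by positivity, 3, ?_⟩
  intro n hn
  obtain ⟨S, hS1, hS2, hS3⟩ := hS n (by omega)
  refine ⟨S, hS1, le_trans ?_ hS2, hS3⟩
  have hn' : (3 : ℝ) ≤ n := by exact_mod_cast hn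
  have hn0 : (0 : ℝ) < n := by linarith
  have hm0 : (0 : ℝ) < m := by
    have : 0 < m := by omega
    exact_mod_cast this
  have hpow : (n : ℝ) ^ (e + 2) = (n : ℝ) ^ (((e + 2 : ℕ) : ℝ)) := (Real.rpow_natCast _ _).symm
  set f := (n : ℝ) ^ (e + 2) / ((n : ℝ) ^ ((k * max m (e + 2) : ℕ) / (m : ℝ)) *
          lgf m (e + 2) n ^ (1 / (m : ℝ))) with hf
  suffices h : fdkr (e + 2) k (m + 1) n ≤ 2 * f by nlinarith
  have hf0 : 0 ≤ f := by
    have := one_le_lgf m (e + 2) n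
    positivity
  rcases lt_trichotomy m (e + 2) with h | h | h
  · have h1 : fdkr (e + 2) k (m + 1) n = f := by
      rw [fdkr, if_pos (by omega), hf, lgf, if_neg (by omega), Real.one_rpow, mul_one,
        max_eq_right h.le, hpow, ← Real.rpow_sub hn0]
      congr 1
      push_cast
      rw [add_sub_cancel_right]
      field_simp
    linarith
  · have hlog : 1 ≤ Real.log n := by
      rw [Real.le_log_iff_exp_le hn0]
      have := Real.exp_one_lt_d9
      linarith
    have h1 : f = (n : ℝ) ^ (((e + 2 : ℕ) : ℝ) - k) / (1 + Real.log n) ^ (1 / ((e + 2 : ℕ) : ℝ)) := by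
      rw [hf, lgf, if_pos h, h, max_self, hpow, Real.rpow_sub hn0, div_div]
      congr 3
      push_cast
      field_simp
    rw [fdkr, if_neg (by omega), if_pos (by omega), h1]
    have h2 : (1 + Real.log n) ^ (1 / ((e + 2 : ℕ) : ℝ)) ≤ 2 * Real.log n ^ (1 / ((e + 2 : ℕ) : ℝ)) := by
      calc (1 + Real.log n) ^ (1 / ((e + 2 : ℕ) : ℝ)) ≤ (2 * Real.log n) ^ (1 / ((e + 2 : ℕ) : ℝ)) := by
            apply Real.rpow_le_rpow (by linarith) (by linarith) (by positivity)
        _ = 2 ^ (1 / ((e + 2 : ℕ) : ℝ)) * Real.log n ^ (1 / ((e + 2 : ℕ) : ℝ)) :=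
            Real.mul_rpow (by norm_num) (by linarith)
        _ ≤ (2 : ℝ) ^ (1 : ℝ) * Real.log n ^ (1 / ((e + 2 : ℕ) : ℝ)) := by
            gcongr
            · norm_num
            · rw [div_le_one (by positivity)]
              push_cast
              have : (0 : ℝ) ≤ e := by positivity
              linarith
        _ = _ := by rw [Real.rpow_one]
    have hl0 : 0 < Real.log n := by linarith
    rw [← mul_div_assoc, div_le_div_iff₀ (by positivity) (by positivity)]
    have h3 : 0 ≤ (n : ℝ) ^ (((e + 2 : ℕ) : ℝ) - k) := by positivity
    nlinarith
  · have h1 : fdkr (e + 2) k (m + 1) n = f := by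
      rw [fdkr, if_neg (by omega), if_neg (by omega), hf, lgf, if_neg (by omega), Real.one_rpow,
        mul_one, max_eq_left h.le, hpow, ← Real.rpow_sub hn0]
      congr 1
      push_cast
      field_simp
    linarith
end

section
/- Let d, k, r be positive integers with k < d and r ≥ k + 1. Define g_{d,k,r}(n) = n^{d(r-k)/(r-1)} if r < d, and g_{d,k,r}(n) = n^{d(d-k)/(d-1)}/(log n)^{1/(d-1)} if r ≥ d. Then there exist a constant c > 0 and N ∈ ℕ such that for every n ≥ N there is a subset S of [n]^d with |S| ≥ c · g_{d,k,r}(n) such that every linear subspace of ℝ^d of dimension at most k contains at most r − 1 points of S. -/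
/-- The function `g_{d,k,r}(n)` from Theorem 1.2. -/
noncomputable def gdkr (d k r n : ℕ) : ℝ :=
  if r < d then (n : ℝ) ^ ((d : ℝ) * ((r : ℝ) - (k : ℝ)) / ((r : ℝ) - 1))
  else (n : ℝ) ^ ((d : ℝ) * ((d : ℝ) - (k : ℝ)) / ((d : ℝ) - 1)) /
    Real.log n ^ ((1 : ℝ) / ((d : ℝ) - 1))

namespace LE
open Module
abbrev E (d : ℕ) := EuclideanSpace ℝ (Fin d)
def io {d : ℕ} (z : Fin d → ℤ) : E d := WithLp.toLp 2 (fun i => (z i : ℝ))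

lemma io_apply {d : ℕ} (z : Fin d → ℤ) (i : Fin d) : io z i = (z i : ℝ) := rfl
lemma io_sub {d : ℕ} (x y : Fin d → ℤ) : io (x - y) = io x - io y := by
  ext i; simp [io]
lemma io_add {d : ℕ} (x y : Fin d → ℤ) : io (x + y) = io x + io y := by
  ext i; simp [io]
lemma io_zero {d : ℕ} : io (0 : Fin d → ℤ) = 0 := by
  ext i; simp [io]
lemma io_inj {d : ℕ} : Function.Injective (io : (Fin d → ℤ) → E d) := by
  intro x y h
  ext i
  have := congrArg (fun v : E d => v i) h
  simpa [io] using this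
lemma coord_le {d : ℕ} (z : Fin d → ℤ) (i : Fin d) : |(z i : ℝ)| ≤ ‖io z‖ := by
  have := PiLp.norm_apply_le (io z) i
  simpa [io_apply] using this
lemma one_le {d : ℕ} (z : Fin d → ℤ) (h : z ≠ 0) : 1 ≤ ‖io z‖ := by
  obtain ⟨i, hi⟩ := Function.ne_iff.1 h
  refine le_trans ?_ (coord_le z i)
  exact_mod_cast Int.one_le_abs hi
lemma norm_le {d : ℕ} (z : Fin d → ℤ) (n : ℝ) (h : ∀ i, |(z i : ℝ)| ≤ n) : ‖io z‖ ≤ d * n := by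
  have h1 : io z = ∑ i, (z i : ℝ) • EuclideanSpace.single i (1:ℝ) := by
    ext j; simp [io, Pi.single_apply]
  rw [h1]
  refine (norm_sum_le _ _).trans ?_
  calc _ ≤ ∑ i : Fin d, n := Finset.sum_le_sum fun i _ => by simpa [norm_smul] using h i
    _ = _ := by simp

lemma pack {d : ℕ} (U : Submodule ℝ (E d)) (j : ℕ) (hj : finrank ℝ U = j)
    (X : Finset (Fin d → ℤ)) (R s : ℝ) (hs : 0 < s) (hsR : s ≤ R)
    (hX : ∀ x ∈ X, ∀ y ∈ X, io x - io y ∈ U ∧ ‖io x - io y‖ ≤ R) (K : ℝ) (hK0 : 0 ≤ K)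
    (hK : ∀ Y ⊆ X, (∀ x ∈ Y, ∀ y ∈ Y, ‖io x - io y‖ < s) → (Y.card : ℝ) ≤ K) :
    (X.card : ℝ) ≤ ((2 * j + 4) * (R / s)) ^ j * K := by
  classical
  have hRs : 1 ≤ R / s := (one_le_div hs).2 hsR
  rcases X.eq_empty_or_nonempty with rfl | ⟨x0, hx0⟩
  · simp; positivity
  have b : OrthonormalBasis (Fin j) ℝ U := (stdOrthonormalBasis ℝ U).reindex (finCongr hj)
  set a : ℝ := s / (j + 1) with ha
  have ha0 : 0 < a := by positivity
  let φ : (Fin d → ℤ) → (Fin j → ℤ) := fun x i => ⌊inner ℝ (b i : E d) (io x - io x0) / a⌋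
  let J : Finset (Fin j → ℤ) := Fintype.piFinset fun _ => Finset.Icc ⌊-R / a⌋ ⌊R / a⌋
  have hbn : ∀ i, ‖(b i : E d)‖ = 1 := fun i => b.orthonormal.1 i
  have hmap : ∀ x ∈ X, φ x ∈ J := by
    intro x hx
    simp only [J, Fintype.mem_piFinset, Finset.mem_Icc, φ]
    intro i
    have h1 : |inner ℝ (b i : E d) (io x - io x0)| ≤ R := by
      refine (abs_real_inner_le_norm _ _).trans ?_
      rw [hbn, one_mul]; exact (hX x hx x0 hx0).2
    rw [abs_le] at h1
    constructor
    · apply Int.floor_le_floor; gcongr; exact h1.1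
    · apply Int.floor_le_floor; gcongr; exact h1.2
  have hfib : ∀ c ∈ J, ((X.filter fun x => φ x = c).card : ℝ) ≤ K := by
    intro c _
    apply hK _ (Finset.filter_subset _ _)
    intro x hx y hy
    simp only [Finset.mem_filter] at hx hy
    have hxy := (hX x hx.1 y hy.1).1
    have hrep : io x - io y = ∑ i, inner ℝ (b i : E d) (io x - io y) • (b i : E d) := by
      have := b.sum_repr' ⟨_, hxy⟩
      have := congrArg (Subtype.val) this
      simp only [Submodule.coe_inner] at this
      rw [Submodule.coe_sum] at this
      exact this.symm
    have hc : ∀ i, |inner ℝ (b i : E d) (io x - io y)| ≤ a := by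
      intro i
      have h1 : φ x i = φ y i := by rw [hx.2, hy.2]
      have h2 := Int.abs_sub_lt_one_of_floor_eq_floor h1
      rw [← sub_div, ← inner_sub_right, abs_div, abs_of_pos ha0, div_lt_one ha0] at h2
      have : io x - io x0 - (io y - io x0) = io x - io y := by abel
      rw [this] at h2; exact h2.le
    rw [hrep]
    calc _ ≤ ∑ i, ‖inner ℝ (b i : E d) (io x - io y) • (b i : E d)‖ := norm_sum_le _ _
      _ ≤ ∑ i : Fin j, a := Finset.sum_le_sum fun i _ => by
          rw [norm_smul, hbn, mul_one]; exact hc i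
      _ = j * a := by simp
      _ < (j + 1) * a := by linarith
      _ = s := by rw [ha]; field_simp
  have hJ : (J.card : ℝ) ≤ ((2 * j + 4) * (R / s)) ^ j := by
    simp only [J, Fintype.card_piFinset, Finset.prod_const, Finset.card_univ, Fintype.card_fin]
    push_cast
    gcongr
    rw [Int.card_Icc]
    have h1 := Int.floor_le (R / a)
    have h2 := Int.lt_floor_add_one (-R / a)
    have h3 : R / a = (j + 1) * (R / s) := by rw [ha]; field_simp
    have h5 : 0 ≤ R / a := by rw [h3]; positivity
    have h4 : (0:ℤ) ≤ ⌊R / a⌋ + 1 - ⌊-R / a⌋ := by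
      have : ⌊-R / a⌋ ≤ ⌊R / a⌋ := Int.floor_le_floor (by rw [neg_div]; linarith)
      omega
    have h6 : (((⌊R / a⌋ + 1 - ⌊-R / a⌋).toNat : ℕ) : ℝ) = ((⌊R / a⌋ + 1 - ⌊-R / a⌋ : ℤ) : ℝ) := by
      exact_mod_cast Int.toNat_of_nonneg h4
    rw [h6]; push_cast
    rw [neg_div] at h2 ⊢
    nlinarith
  rw [Finset.card_eq_sum_card_fiberwise (f := φ) (t := J) (fun x hx => hmap x hx)]
  push_cast
  calc _ ≤ ∑ c ∈ J, K := Finset.sum_le_sum hfib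
    _ = J.card * K := by simp
    _ ≤ _ := by gcongr

lemma count {d : ℕ} (k : ℕ) (W : ℕ → Submodule ℝ (E d)) (m : ℕ → ℝ)
    (hW : ∀ j ≤ k, finrank ℝ (W j) = j) (hpos : ∀ i < k, 0 < m i)
    (hmono : ∀ i j, i ≤ j → j < k → m i ≤ m j)
    (hmin : ∀ j < k, ∀ z : Fin d → ℤ, io z ∈ W (j+1) → io z ∉ W j → m j ≤ ‖io z‖) :
    ∀ j ≤ k, ∀ R : ℝ, (∀ i < j, m i ≤ R) → ∀ X : Finset (Fin d → ℤ),
      (∀ x ∈ X, ∀ y ∈ X, io x - io y ∈ W j ∧ ‖io x - io y‖ ≤ R) →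
      (X.card : ℝ) ≤ (∏ i ∈ Finset.range j, (2 * ((i:ℝ) + 1) + 4) ^ (i+1)) *
        ∏ i ∈ Finset.range j, (R / m i) := by
  intro j
  induction j with
  | zero =>
    intro _ R _ X hX
    simp only [Finset.range_zero, Finset.prod_empty, mul_one]
    have h0 : W 0 = ⊥ := Submodule.finrank_eq_zero.1 (hW 0 (Nat.zero_le _))
    have : X.card ≤ 1 := Finset.card_le_one.2 fun x hx y hy => by
      have := (hX x hx y hy).1
      rw [h0, Submodule.mem_bot, sub_eq_zero] at this
      exact io_inj this
    exact_mod_cast this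
  | succ j ih =>
    intro hjk R hR X hX
    have hs := hpos j (by omega)
    have hpos' : ∀ i ∈ Finset.range j, 0 < m i := fun i hi =>
      hpos i (by have := Finset.mem_range.1 hi; omega)
    have hRj := hR j (by omega)
    have := pack (W (j+1)) (j+1) (hW _ hjk) X R (m j) hs hRj hX
      ((∏ i ∈ Finset.range j, (2 * ((i:ℝ) + 1) + 4) ^ (i+1)) *
        ∏ i ∈ Finset.range j, (m j / m i)) (by
          apply mul_nonneg
          · positivity
          · exact Finset.prod_nonneg fun i hi => (div_pos hs (hpos' i hi)).le) (by
          intro Y hY hYs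
          apply ih (by omega) (m j) (fun i hi => hmono i j hi.le (by omega)) Y
          intro x hx y hy
          refine ⟨?_, (hYs x hx y hy).le⟩
          by_contra hcon
          have h1 := hmin j (by omega) (x - y) (by rw [io_sub]; exact (hX x (hY hx) y (hY hy)).1)
            (by rwa [io_sub])
          rw [io_sub] at h1
          linarith [hYs x hx y hy])
    refine this.trans (le_of_eq ?_)
    rw [Finset.prod_range_succ, Finset.prod_range_succ]
    have h2 : ∏ i ∈ Finset.range j, (R / m i) = (R / m j) ^ j * ∏ i ∈ Finset.range j, (m j / m i) := by
      rw [← Finset.card_range j, ← Finset.prod_const, Finset.card_range, ← Finset.prod_mul_distrib]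
      refine Finset.prod_congr rfl fun i hi => ?_
      have := (hpos' i hi).ne'
      field_simp
    rw [h2, mul_pow, pow_succ (R / m j)]
    push_cast
    generalize (∏ i ∈ Finset.range j, (2 * ((i:ℝ) + 1) + 4) ^ (i+1)) = A
    generalize (2 * ((j:ℝ) + 1) + 4) ^ (j+1) = B
    ring

lemma exists_min {d : ℕ} (P : (Fin d → ℤ) → Prop) (h : ∃ z, P z) :
    ∃ z, P z ∧ ∀ y, P y → ‖io z‖ ≤ ‖io y‖ := by
  let f : (Fin d → ℤ) → ℕ := fun z => (∑ i, (z i)^2).toNat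
  have hf : ∀ z, (f z : ℝ) = ‖io z‖ ^ 2 := by
    intro z
    have h0 : 0 ≤ ∑ i, (z i)^2 := Finset.sum_nonneg fun i _ => sq_nonneg _
    have h1 : ((f z : ℤ) : ℝ) = ((∑ i, (z i)^2 : ℤ) : ℝ) := by
      rw [Int.toNat_of_nonneg h0]
    rw [EuclideanSpace.norm_sq_eq]
    simp only [io_apply, Real.norm_eq_abs, sq_abs]
    push_cast at h1
    exact h1
  obtain ⟨z, hz, hmin⟩ := (measure f).wf.has_min {z | P z} h
  refine ⟨z, hz, fun y hy => ?_⟩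
  have h1 : f z ≤ f y := not_lt.1 (hmin y hy)
  have h2 : (f z : ℝ) ≤ f y := by exact_mod_cast h1
  rw [hf, hf] at h2
  exact (sq_le_sq₀ (norm_nonneg _) (norm_nonneg _)).1 h2

lemma finrank_sup {d : ℕ} (V : Submodule ℝ (E d)) (x : E d) (hx : x ∉ V) :
    finrank ℝ (V ⊔ Submodule.span ℝ {x} : Submodule ℝ (E d)) = finrank ℝ V + 1 := by
  have h := Submodule.finrank_sup_add_finrank_inf_eq V (Submodule.span ℝ {x})
  have hx0 : x ≠ 0 := fun h => hx (h ▸ V.zero_mem)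
  have h1 : V ⊓ Submodule.span ℝ {x} = ⊥ := by
    rw [Submodule.eq_bot_iff]
    rintro y ⟨hy, hy2⟩
    obtain ⟨a, rfl⟩ := Submodule.mem_span_singleton.1 hy2
    by_cases ha : a = 0
    · simp [ha]
    · exact absurd ((V.smul_mem_iff ha).1 hy) hx
  rw [h1, finrank_span_singleton hx0, finrank_bot] at h
  omega

lemma minima {d : ℕ} (W : Submodule ℝ (E d)) (k : ℕ) (hk : finrank ℝ W = k) (R : ℝ)
    (hgen : ∀ V : Submodule ℝ (E d), finrank ℝ V < k → ∃ z : Fin d → ℤ,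
      io z ∈ W ∧ io z ∉ V ∧ ‖io z‖ ≤ R) :
    ∃ (v : ℕ → Fin d → ℤ) (F : ℕ → Submodule ℝ (E d)), F 0 = ⊥ ∧
      (∀ j, F (j+1) = F j ⊔ Submodule.span ℝ {io (v j)}) ∧
      (∀ j ≤ k, finrank ℝ (F j) = j) ∧ (∀ j ≤ k, F j ≤ W) ∧
      ∀ j < k, io (v j) ∈ W ∧ io (v j) ∉ F j ∧ ‖io (v j)‖ ≤ R ∧
        ∀ z : Fin d → ℤ, io z ∈ W → io z ∉ F j → ‖io (v j)‖ ≤ ‖io z‖ := by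
  have key : ∀ V : Submodule ℝ (E d), ∃ y : Fin d → ℤ, finrank ℝ V < k →
      io y ∈ W ∧ io y ∉ V ∧ ‖io y‖ ≤ R ∧
        ∀ z : Fin d → ℤ, io z ∈ W → io z ∉ V → ‖io y‖ ≤ ‖io z‖ := by
    intro V
    by_cases hV : finrank ℝ V < k
    · obtain ⟨z, h1, h2, h3⟩ := hgen V hV
      obtain ⟨y, hy, hy2⟩ := exists_min (fun z => io z ∈ W ∧ io z ∉ V) ⟨z, h1, h2⟩
      exact ⟨y, fun _ => ⟨hy.1, hy.2, (hy2 z ⟨h1, h2⟩).trans h3, fun z a b => hy2 z ⟨a, b⟩⟩⟩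
    · exact ⟨0, fun h => absurd h hV⟩
  choose nxt hn using key
  obtain ⟨F, hF0, hF⟩ : ∃ F : ℕ → Submodule ℝ (E d), F 0 = ⊥ ∧
      ∀ j, F (j+1) = F j ⊔ Submodule.span ℝ {io (nxt (F j))} :=
    ⟨fun j => Nat.rec ⊥ (fun _ V => V ⊔ Submodule.span ℝ {io (nxt V)}) j, rfl, fun _ => rfl⟩
  have hall : ∀ j ≤ k, finrank ℝ (↥(F j)) = j ∧ F j ≤ W := by
    intro j
    induction j with
    | zero => intro _; rw [hF0]; exact ⟨finrank_bot ℝ (E d), bot_le⟩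
    | succ j ih =>
      intro hj
      obtain ⟨h1, h2⟩ := ih (by omega)
      have h3 := hn (F j) (by omega)
      rw [hF]
      refine ⟨by rw [finrank_sup _ _ h3.2.1, h1], sup_le h2 ?_⟩
      rw [Submodule.span_singleton_le_iff_mem]
      exact h3.1
  refine ⟨fun j => nxt (F j), F, hF0, hF, fun j hj => (hall j hj).1, fun j hj => (hall j hj).2, ?_⟩
  intro j hj
  exact hn (F j) (by rw [(hall j hj.le).1]; exact hj)

def Sp {d k : ℕ} (v0 : Fin d → ℤ) (w : Fin k → Fin d → ℤ) : Submodule ℝ (E d) :=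
  Submodule.span ℝ (insert (io v0) (Set.range fun i => io (w i)))

noncomputable def CC (k : ℕ) : ℝ := ∏ i ∈ Finset.range (k+1), (2 * ((i:ℝ) + 1) + 4) ^ (i+1)

lemma CC_pos (k : ℕ) : 0 < CC k := by unfold CC; positivity

noncomputable def box (d n : ℕ) : Finset (Fin d → ℤ) := Fintype.piFinset fun _ => Finset.Icc 1 (n:ℤ)

lemma mem_box {d n : ℕ} {z : Fin d → ℤ} : z ∈ box d n ↔ ∀ i, 1 ≤ z i ∧ z i ≤ n := by
  simp [box]

open Classical in
noncomputable def Pts {d k : ℕ} (n : ℕ) (v0 : Fin d → ℤ) (w : Fin k → Fin d → ℤ) :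
    Finset (Fin d → ℤ) := (box d n).filter fun z => io z ∈ Sp v0 w

lemma tuple_cover {d k r n : ℕ} (x : Fin r → Fin d → ℤ) (hx : ∀ l, x l ∈ box d n)
    (hr : finrank ℝ (Submodule.span ℝ (Set.range fun l => io (x l))) = k + 1) :
    ∃ (v0 : Fin d → ℤ) (w : Fin k → Fin d → ℤ), v0 ≠ 0 ∧ ‖io v0‖ ≤ d * n ∧
      (∀ i, ‖io v0‖ ≤ ‖io (w i)‖ ∧ ‖io (w i)‖ ≤ d * n ∧
        2 * |inner ℝ (io (w i)) (io v0)| ≤ ‖io v0‖ ^ 2) ∧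
      (∀ l, x l ∈ Pts n v0 w) ∧
      ((Pts n v0 w).card : ℝ) ≤ CC k * ((d * n / ‖io v0‖) * ∏ i, (d * n / ‖io (w i)‖)) := by
  classical
  set W := Submodule.span ℝ (Set.range fun l => io (x l)) with hWdef
  have hxn : ∀ l, ‖io (x l)‖ ≤ d * n := fun l => norm_le _ _ fun i => by
    have := mem_box.1 (hx l) i
    rw [abs_of_nonneg (by exact_mod_cast (by omega : (0:ℤ) ≤ x l i))]
    exact_mod_cast this.2
  obtain ⟨v, F, hF0, hFs, hFr, hFW, hv⟩ := minima W (k+1) hr (d * n) (by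
    intro V hV
    by_contra! hcon
    have : W ≤ V := by
      rw [hWdef, Submodule.span_le]
      rintro _ ⟨l, rfl⟩
      by_contra hl
      have := hcon (x l) (Submodule.subset_span ⟨l, rfl⟩) hl
      linarith [hxn l]
    have := Submodule.finrank_mono this
    omega)
  have hFm : Monotone F := monotone_nat_of_le_succ fun j => by rw [hFs]; exact le_sup_left
  have hFmem : ∀ i j, i < j → io (v i) ∈ F j := fun i j hij => by
    apply hFm (show i + 1 ≤ j from hij)
    rw [hFs]
    exact Submodule.mem_sup_right (Submodule.mem_span_singleton_self _)
  have hmono : ∀ i j, i ≤ j → j < k+1 → ‖io (v i)‖ ≤ ‖io (v j)‖ := fun i j hij hj =>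
    (hv i (by omega)).2.2.2 _ (hv j hj).1 fun h => (hv j hj).2.1 (hFm hij h)
  have hne : ∀ i < k+1, v i ≠ 0 := fun i hi h => (hv i hi).2.1 (by
    rw [h, io_zero]; exact Submodule.zero_mem _)
  have hFk : F (k+1) = W :=
    Submodule.eq_of_le_of_finrank_eq (hFW _ le_rfl) (by rw [hFr _ le_rfl, hr])
  have hSp : Sp (v 0) (fun i : Fin k => v (i+1)) = W := by
    apply le_antisymm
    · rw [Sp, Submodule.span_le]
      rintro _ (rfl | ⟨i, rfl⟩)
      · exact (hv 0 (by omega)).1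
      · exact (hv _ (by omega)).1
    · rw [← hFk]
      have : ∀ j ≤ k+1, F j ≤ Sp (v 0) (fun i : Fin k => v (i+1)) := by
        intro j
        induction j with
        | zero => intro _; rw [hF0]; exact bot_le
        | succ j ih =>
          intro hj
          rw [hFs]
          refine sup_le (ih (by omega)) ?_
          rw [Submodule.span_singleton_le_iff_mem]
          apply Submodule.subset_span
          rcases j with _ | j
          · left; rfl
          · right; exact ⟨⟨j, by omega⟩, rfl⟩
      exact this _ le_rfl
  refine ⟨v 0, fun i => v (i+1), hne 0 (by omega), (hv 0 (by omega)).2.2.1, ?_, ?_, ?_⟩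
  · intro i
    refine ⟨hmono 0 _ (by omega) (by omega), (hv _ (by omega)).2.2.1, ?_⟩
    have hvi := hv (i+1) (by omega)
    have h0 := hFmem 0 (i+1) (by omega)
    have h1 := hvi.2.2.2 (v (i+1) + v 0)
      (by rw [io_add]; exact W.add_mem hvi.1 (hv 0 (by omega)).1)
      (by rw [io_add]; exact fun h => hvi.2.1 ((Submodule.add_mem_iff_left _ h0).1 h))
    have h2 := hvi.2.2.2 (v (i+1) - v 0)
      (by rw [io_sub]; exact W.sub_mem hvi.1 (hv 0 (by omega)).1)
      (by rw [io_sub]; exact fun h => hvi.2.1 ((Submodule.sub_mem_iff_left _ h0).1 h))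
    rw [io_add] at h1
    rw [io_sub] at h2
    have h3 := pow_le_pow_left₀ (norm_nonneg _) h1 2
    have h4 := pow_le_pow_left₀ (norm_nonneg _) h2 2
    rw [norm_add_sq_real] at h3
    rw [norm_sub_sq_real] at h4
    have : |inner ℝ (io (v (i+1))) (io (v 0))| ≤ ‖io (v 0)‖ ^ 2 / 2 := by
      rw [abs_le]; constructor <;> linarith
    linarith
  · intro l
    simp only [Pts, Finset.mem_filter]
    refine ⟨hx l, ?_⟩
    rw [hSp]; exact Submodule.subset_span ⟨l, rfl⟩
  · have := count (k+1) F (fun i => ‖io (v i)‖) hFr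
      (fun i hi => lt_of_lt_of_le one_pos (one_le _ (hne i hi))) hmono
      (fun j hj z hz hz2 => (hv j hj).2.2.2 z (hFW _ hj hz) hz2) (k+1) le_rfl (d * n)
      (fun i hi => (hv i hi).2.2.1) (Pts n (v 0) (fun i : Fin k => v (i+1))) (by
        intro y hy z hz
        simp only [Pts, Finset.mem_filter, hSp] at hy hz
        rw [hFk, ← io_sub]
        refine ⟨by rw [io_sub]; exact W.sub_mem hy.2 hz.2, norm_le _ _ fun i => ?_⟩
        have h1 := mem_box.1 hy.1 i
        have h2 := mem_box.1 hz.1 i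
        have : |(y - z) i| ≤ (n:ℤ) := by rw [Pi.sub_apply, abs_le]; constructor <;> omega
        exact_mod_cast this)
    refine this.trans (le_of_eq ?_)
    rw [← CC, Finset.prod_range_succ', ← Fin.prod_univ_eq_prod_range (fun i => (d:ℝ) * n / ‖io (v (i+1))‖) k, mul_comm (∏ i, _)]

lemma dyadic {α : Type*} (F : Finset α) (f : α → ℝ) (m : ℝ) (hm : 0 < m)
    (hf : ∀ v ∈ F, m ≤ f v) (T : ℕ) (hT : ∀ v ∈ F, f v < 2 ^ T * m) (A : ℕ → ℝ) (p : ℕ)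
    (hA : ∀ t, ((F.filter fun v => f v ≤ 2 ^ (t+1) * m).card : ℝ) ≤ A t) :
    ∑ v ∈ F, (1 / f v) ^ p ≤ ∑ t ∈ Finset.range T, A t * (1 / (2 ^ t * m)) ^ p := by
  classical
  let g : α → ℕ := fun v => Nat.log 2 ⌊f v / m⌋₊
  have hg : ∀ v ∈ F, 2 ^ (g v) * m ≤ f v ∧ f v < 2 ^ (g v + 1) * m := by
    intro v hv
    have h1 : 1 ≤ f v / m := (one_le_div hm).2 (hf v hv)
    have h2 : ⌊f v / m⌋₊ ≠ 0 := by
      have := Nat.le_floor (α := ℝ) (n := 1) (by simpa using h1)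
      omega
    have h3 : 2 ^ g v ≤ ⌊f v / m⌋₊ := Nat.pow_log_le_self 2 h2
    have h4 : ⌊f v / m⌋₊ < 2 ^ (g v + 1) := Nat.lt_pow_succ_log_self (by norm_num) _
    have h5 : ((2 ^ g v : ℕ) : ℝ) ≤ f v / m := (Nat.le_floor_iff (by positivity)).1 h3
    have h6 : f v / m < ((2 ^ (g v + 1) : ℕ) : ℝ) := (Nat.floor_lt (by positivity)).1 h4
    push_cast at h5 h6
    exact ⟨(le_div_iff₀ hm).1 h5, (div_lt_iff₀ hm).1 h6⟩
  have hgT : ∀ v ∈ F, g v ∈ Finset.range T := by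
    intro v hv
    have h1 := (hg v hv).1.trans_lt (hT v hv)
    have h2 : (2:ℝ) ^ g v < 2 ^ T := lt_of_mul_lt_mul_right h1 hm.le
    exact Finset.mem_range.2 ((pow_lt_pow_iff_right₀ (by norm_num)).1 h2)
  rw [← Finset.sum_fiberwise_of_maps_to hgT]
  refine Finset.sum_le_sum fun t _ => ?_
  calc _ ≤ ∑ v ∈ F.filter (fun v => g v = t), (1 / (2 ^ t * m)) ^ p := by
        refine Finset.sum_le_sum fun v hv => ?_
        rw [Finset.mem_filter] at hv
        have h1 := (hg v hv.1).1
        rw [hv.2] at h1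
        have : 0 < f v := lt_of_lt_of_le hm (hf v hv.1)
        gcongr
    _ = ((F.filter (fun v => g v = t)).card : ℝ) * (1 / (2 ^ t * m)) ^ p := by simp
    _ ≤ _ := by
        gcongr
        refine le_trans ?_ (hA t)
        refine Nat.cast_le.2 (Finset.card_le_card fun v hv => ?_)
        rw [Finset.mem_filter] at hv ⊢
        refine ⟨hv.1, ?_⟩
        rw [← hv.2]; exact (hg v hv.1).2.le

lemma card_cube {d : ℕ} (F : Finset (Fin d → ℤ)) (M : ℝ) (hM : 1 ≤ M)
    (h : ∀ z ∈ F, ∀ i, |(z i : ℝ)| ≤ M) : (F.card : ℝ) ≤ (3 * M) ^ d := by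
  have h1 : F ⊆ Fintype.piFinset fun _ => Finset.Icc (-⌊M⌋) ⌊M⌋ := by
    intro z hz
    simp only [Fintype.mem_piFinset, Finset.mem_Icc]
    intro i
    have := abs_le.1 (h z hz i)
    refine ⟨?_, Int.le_floor.2 this.2⟩
    have : -z i ≤ ⌊M⌋ := Int.le_floor.2 (by push_cast; linarith)
    omega
  have h2 := Finset.card_le_card h1
  simp only [Fintype.card_piFinset, Finset.prod_const, Finset.card_univ, Fintype.card_fin,
    Int.card_Icc] at h2
  have h0 : 0 ≤ ⌊M⌋ := Int.floor_nonneg.2 (by linarith)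
  have h3 : ((⌊M⌋ + 1 - -⌊M⌋).toNat : ℝ) ≤ 3 * M := by
    have : ((⌊M⌋ + 1 - -⌊M⌋).toNat : ℝ) = ((⌊M⌋ + 1 - -⌊M⌋ : ℤ) : ℝ) := by
      exact_mod_cast Int.toNat_of_nonneg (by omega)
    rw [this]; push_cast; linarith [Int.floor_le M]
  calc (F.card : ℝ) ≤ (((⌊M⌋ + 1 - -⌊M⌋).toNat ^ d : ℕ) : ℝ) := by exact_mod_cast h2
    _ ≤ _ := by push_cast; gcongr

lemma card_slab {e : ℕ} (F : Finset (Fin (e+1) → ℤ)) (M : ℝ) (hM : 1 ≤ M)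
    (v0 : Fin (e+1) → ℤ) (hv0 : v0 ≠ 0)
    (h : ∀ z ∈ F, ‖io z‖ ≤ M ∧ 2 * |inner ℝ (io z) (io v0)| ≤ ‖io v0‖ ^ 2) :
    (F.card : ℝ) ≤ (3 * (((e:ℝ)+1) * ‖io v0‖)) * (3 * M) ^ e := by
  classical
  obtain ⟨i, -, hi⟩ := Finset.exists_max_image Finset.univ (fun i => |(v0 i : ℝ)|)
    Finset.univ_nonempty
  have hm := one_le v0 hv0
  have hvi : ‖io v0‖ ≤ ((e:ℝ)+1) * |(v0 i : ℝ)| := by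
    have := norm_le v0 |(v0 i : ℝ)| (fun j => hi j (Finset.mem_univ _))
    push_cast at this; exact this
  have hvi0 : 0 < |(v0 i : ℝ)| := by
    by_contra hc
    have : |(v0 i : ℝ)| = 0 := le_antisymm (not_lt.1 hc) (abs_nonneg _)
    rw [this] at hvi; linarith
  set D : ℝ := ((e:ℝ)+1) * ‖io v0‖ with hD
  have hD1 : 1 ≤ D := by nlinarith [(Nat.cast_nonneg e : (0:ℝ) ≤ e)]
  let φ : (Fin (e+1) → ℤ) → (Fin e → ℤ) := fun z j => z (i.succAbove j)
  have himg : ((F.image φ).card : ℝ) ≤ (3 * M) ^ e := by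
    apply card_cube _ M hM
    intro y hy j
    obtain ⟨z, hz, rfl⟩ := Finset.mem_image.1 hy
    exact (coord_le z _).trans (h z hz).1
  have hfib : ∀ y ∈ F.image φ, ((F.filter fun z => φ z = y).card : ℝ) ≤ 3 * D := by
    intro y hy
    obtain ⟨z0, hz0, rfl⟩ := Finset.mem_image.1 hy
    have hinj : Set.InjOn (fun (z : Fin (e+1) → ℤ) => (fun _ : Fin 1 => z i - z0 i))
        (F.filter fun z => φ z = φ z0) := by
      intro z hz z' hz' hzz
      simp only [Finset.coe_filter, Set.mem_ofPred_eq] at hz hz'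
      ext j
      rcases Fin.eq_self_or_eq_succAbove i j with rfl | ⟨l, rfl⟩
      · have := congrFun hzz 0
        simp only at this; omega
      · have := congrFun (hz.2.trans hz'.2.symm) l
        exact this
    rw [← Finset.card_image_of_injOn hinj]
    have := card_cube ((F.filter fun z => φ z = φ z0).image
      (fun (z : Fin (e+1) → ℤ) => (fun _ : Fin 1 => z i - z0 i))) D hD1 (by
      intro u hu _
      obtain ⟨z, hz, rfl⟩ := Finset.mem_image.1 hu
      rw [Finset.mem_filter] at hz
      have h1 := (h z hz.1).2
      have h2 := (h z0 hz0).2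
      have h3 : inner ℝ (io z) (io v0) - inner ℝ (io z0) (io v0) = ((z i : ℝ) - z0 i) * v0 i := by
        rw [← inner_sub_left, ← io_sub]
        simp only [PiLp.inner_apply, io_apply, RCLike.inner_apply, conj_trivial]
        rw [Fin.sum_univ_succAbove _ i, Finset.sum_eq_zero]
        · simp; ring
        · intro l _
          have : z (i.succAbove l) = z0 (i.succAbove l) := congrFun hz.2 l
          simp [this]
      have h4 : |(z i : ℝ) - z0 i| * |(v0 i : ℝ)| ≤ ‖io v0‖ ^ 2 := by
        rw [← abs_mul, ← h3]
        refine (abs_sub _ _).trans ?_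
        linarith
      push_cast
      have h5 : ‖io v0‖ ^ 2 ≤ D * |(v0 i : ℝ)| := by
        rw [hD]; nlinarith
      exact le_of_mul_le_mul_right (h4.trans h5) hvi0)
    simpa using this
  have hcard : (F.card : ℝ) = ∑ y ∈ F.image φ, ((F.filter fun z => φ z = y).card : ℝ) := by
    exact_mod_cast Finset.card_eq_sum_card_image φ F
  rw [hcard]
  calc _ ≤ ∑ y ∈ F.image φ, 3 * D := Finset.sum_le_sum hfib
    _ = 3 * D * (F.image φ).card := by simp [mul_comm]
    _ ≤ _ := by gcongr

noncomputable def CS (d : ℕ) : ℝ := 2 * (3 * d * 6 ^ d)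

lemma sum_slab {d : ℕ} (hd : 0 < d) (F : Finset (Fin d → ℤ)) 
    (v0 : Fin d → ℤ) (hv0 : v0 ≠ 0)
    (h : ∀ z ∈ F, ‖io v0‖ ≤ ‖io z‖ ∧ 2 * |inner ℝ (io z) (io v0)| ≤ ‖io v0‖ ^ 2) :
    ∑ z ∈ F, (1 / ‖io z‖) ^ d ≤ CS d := by
  obtain ⟨e, rfl⟩ : ∃ e, d = e + 1 := ⟨d - 1, by omega⟩
  have hm := one_le v0 hv0
  set m := ‖io v0‖ with hmdef
  obtain ⟨T, hT⟩ : ∃ T : ℕ, ∀ z ∈ F, ‖io z‖ < 2 ^ T * m := by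
    obtain ⟨T, hT⟩ := pow_unbounded_of_one_lt (∑ z ∈ F, ‖io z‖) (one_lt_two (α := ℝ))
    refine ⟨T, fun z hz => ?_⟩
    have h1 := Finset.single_le_sum (f := fun z => ‖io z‖) (fun z _ => norm_nonneg _) hz
    have h2 : (0:ℝ) < 2 ^ T := by positivity
    nlinarith
  refine (dyadic F (fun z => ‖io z‖) m (by linarith) (fun z hz => (h z hz).1) T hT
    (fun t => (3 * (((e:ℝ)+1) * m)) * (3 * (2 ^ (t+1) * m)) ^ e) (e+1) ?_).trans ?_
  · intro t
    apply card_slab _ _ ?_ v0 hv0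
    · intro z hz
      rw [Finset.mem_filter] at hz
      exact ⟨hz.2, (h z hz.1).2⟩
    · have : (1:ℝ) ≤ 2 ^ (t+1) := one_le_pow₀ (by norm_num)
      nlinarith
  · have : ∀ t ∈ Finset.range T, (3 * (((e:ℝ)+1) * m)) * (3 * (2 ^ (t+1) * m)) ^ e *
        (1 / (2 ^ t * m)) ^ (e+1) = (3 * ((e:ℝ)+1) * 6 ^ e) * (1 / 2) ^ t := by
      intro t _
      have h1 : 3 * (2 ^ (t+1) * m) = 6 * (2 ^ t * m) := by ring
      have h2 : (0:ℝ) < 2 ^ t := by positivity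
      rw [h1, mul_pow 6, pow_succ (1 / (2 ^ t * m)), one_div_pow, one_div_pow]
      have : (0:ℝ) < (2 ^ t * m) ^ e := by positivity
      field_simp
    rw [Finset.sum_congr rfl this, ← Finset.mul_sum, CS, mul_comm]
    have h3 := sum_geometric_two_le T
    push_cast
    gcongr
    · norm_num
    · omega

lemma tsum_v0 {d r R : ℕ} (hr : r ≤ d) (hR : 0 < R) (F : Finset (Fin d → ℤ))
    (h : ∀ z ∈ F, z ≠ 0 ∧ ‖io z‖ ≤ R) :
    ∑ z ∈ F, ((R:ℝ) / ‖io z‖) ^ r ≤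
      6 ^ d * R ^ d * (if r < d then 2 else (Nat.log 2 R + 1 : ℝ)) := by
  have hT : ∀ z ∈ F, ‖io z‖ < 2 ^ (Nat.log 2 R + 1) * 1 := by
    intro z hz
    rw [mul_one]
    refine (h z hz).2.trans_lt ?_
    exact_mod_cast Nat.lt_pow_succ_log_self (by norm_num : 1 < 2) R
  have hdy := fun p => dyadic F (fun z => ‖io z‖) 1 one_pos (fun z hz => one_le z (h z hz).1)
    _ hT (fun t => (3 * (2 ^ (t+1) * 1)) ^ d) p (by
      intro t
      apply card_cube
      · have : (1:ℝ) ≤ 2 ^ (t+1) := one_le_pow₀ (by norm_num)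
        linarith
      · intro z hz i
        rw [Finset.mem_filter] at hz
        exact (coord_le z i).trans hz.2)
  have hsplit : ∀ p, ∑ z ∈ F, ((R:ℝ) / ‖io z‖) ^ p = R ^ p * ∑ z ∈ F, (1 / ‖io z‖) ^ p := by
    intro p
    rw [Finset.mul_sum]
    refine Finset.sum_congr rfl fun z _ => ?_
    rw [← mul_pow, mul_one_div]
  split_ifs with hlt
  · obtain ⟨e, rfl⟩ : ∃ e, d = e + 1 := ⟨d - 1, by omega⟩
    calc ∑ z ∈ F, ((R:ℝ) / ‖io z‖) ^ r ≤ ∑ z ∈ F, ((R:ℝ) / ‖io z‖) ^ e := by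
          refine Finset.sum_le_sum fun z hz => ?_
          apply pow_le_pow_right₀
          · have := one_le z (h z hz).1
            rw [one_le_div (by linarith)]
            exact (h z hz).2
          · omega
      _ = R ^ e * ∑ z ∈ F, (1 / ‖io z‖) ^ e := hsplit e
      _ ≤ R ^ e * ∑ t ∈ Finset.range (Nat.log 2 R + 1),
            (3 * (2 ^ (t+1) * 1)) ^ (e+1) * (1 / (2 ^ t * 1)) ^ e := by
          gcongr; exact hdy e
      _ = R ^ e * (6 ^ (e+1) * ∑ t ∈ Finset.range (Nat.log 2 R + 1), (2:ℝ) ^ t) := by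
          congr 1
          rw [Finset.mul_sum]
          refine Finset.sum_congr rfl fun t _ => ?_
          have h1 : (3:ℝ) * (2 ^ (t+1) * 1) = 6 * 2 ^ t := by ring
          have h2 : (0:ℝ) < (2 ^ t) ^ e := by positivity
          rw [h1, mul_pow, mul_one, one_div_pow, pow_succ ((2:ℝ)^t)]
          field_simp
      _ ≤ R ^ e * (6 ^ (e+1) * (2 * R)) := by
          gcongr
          rw [geom_sum_eq (by norm_num)]
          have : (2:ℝ) ^ (Nat.log 2 R) ≤ R := by
            exact_mod_cast Nat.pow_log_le_self 2 hR.ne'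
          rw [pow_succ]
          linarith
      _ = _ := by ring
  · have : r = d := by omega
    subst this
    rw [hsplit]
    have h2 : ∑ t ∈ Finset.range (Nat.log 2 R + 1),
        ((3:ℝ) * (2 ^ (t+1) * 1)) ^ r * (1 / (2 ^ t * 1)) ^ r = 6 ^ r * (Nat.log 2 R + 1) := by
      rw [Finset.sum_congr rfl (g := fun _ => (6:ℝ) ^ r)]
      · simp; ring
      · intro t _
        rw [← mul_pow]
        congr 1
        field_simp
        ring
    have h3 := hdy r
    rw [h2] at h3
    calc _ ≤ (R:ℝ) ^ r * (6 ^ r * (Nat.log 2 R + 1)) := by gcongr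
      _ = _ := by ring

noncomputable def ball0 (d R : ℕ) : Finset (Fin d → ℤ) := by
  classical
  exact (Fintype.piFinset fun _ => Finset.Icc (-(R:ℤ)) R).filter fun z => z ≠ 0 ∧ ‖io z‖ ≤ R

lemma mem_ball0 {d R : ℕ} {z : Fin d → ℤ} : z ∈ ball0 d R ↔ z ≠ 0 ∧ ‖io z‖ ≤ R := by
  classical
  simp only [ball0, Finset.mem_filter, Fintype.mem_piFinset, Finset.mem_Icc, and_iff_right_iff_imp]
  intro h i
  have := abs_le.1 ((coord_le z i).trans h.2)
  constructor
  · exact_mod_cast this.1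
  · exact_mod_cast this.2

noncomputable def slab (d R : ℕ) (v0 : Fin d → ℤ) : Finset (Fin d → ℤ) := by
  classical
  exact (ball0 d R).filter fun z => ‖io v0‖ ≤ ‖io z‖ ∧ 2 * |inner ℝ (io z) (io v0)| ≤ ‖io v0‖ ^ 2

open Classical in
noncomputable def tups (d r n k : ℕ) : Finset (Fin r → Fin d → ℤ) :=
  (Fintype.piFinset fun _ => box d n).filter fun x =>
    finrank ℝ (Submodule.span ℝ (Set.range fun l => io (x l))) = k

noncomputable def lam (d r R : ℕ) : ℝ := if r < d then 2 else (Nat.log 2 R + 1 : ℝ)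

lemma card_tups {d r n k : ℕ} (hd : 0 < d) (hr : r ≤ d) (hn : 0 < n) :
    ((tups d r n (k+1)).card : ℝ) ≤ CC k ^ r * CS d ^ k * 6 ^ d *
      ((d * n : ℕ) : ℝ) ^ (d * (k+1)) * lam d r (d * n) := by
  classical
  set R : ℕ := d * n with hRdef
  have hR : 0 < R := Nat.mul_pos hd hn
  have hRc : (d:ℝ) * n = (R:ℝ) := by rw [hRdef]; push_cast; rfl
  have hR' : (0:ℝ) < R := by exact_mod_cast hR
  let good : (Fin d → ℤ) → (Fin k → Fin d → ℤ) → Prop := fun v0 w =>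
    ((Pts n v0 w).card : ℝ) ≤ CC k * ((R / ‖io v0‖) * ∏ i, (R / ‖io (w i)‖))
  have hsub : tups d r n (k+1) ⊆ (ball0 d R).biUnion fun v0 =>
      ((Fintype.piFinset fun _ : Fin k => slab d R v0).filter (good v0)).biUnion fun w =>
        Fintype.piFinset fun _ : Fin r => Pts n v0 w := by
    intro x hx
    simp only [tups, Finset.mem_filter, Fintype.mem_piFinset] at hx
    obtain ⟨v0, w, h1, h2, h3, h4, h5⟩ := tuple_cover x hx.1 hx.2
    rw [hRc] at h2 h5
    simp only [hRc] at h3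
    simp only [Finset.mem_biUnion, Finset.mem_filter, Fintype.mem_piFinset]
    refine ⟨v0, mem_ball0.2 ⟨h1, h2⟩, w, ⟨fun i => ?_, h5⟩, h4⟩
    rw [slab, Finset.mem_filter, mem_ball0]
    refine ⟨⟨?_, (h3 i).2.1⟩, (h3 i).1, (h3 i).2.2⟩
    intro hw
    have := (one_le v0 h1).trans (h3 i).1
    rw [hw, io_zero, norm_zero] at this
    linarith
  have hslab : ∀ v0 ∈ ball0 d R, ∑ z ∈ slab d R v0, ((R:ℝ) / ‖io z‖) ^ d ≤ R ^ d * CS d := by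
    intro v0 hv0
    have := sum_slab hd (slab d R v0) v0 (mem_ball0.1 hv0).1 (fun z hz => by
      rw [slab, Finset.mem_filter] at hz; exact hz.2)
    calc _ = (R:ℝ) ^ d * ∑ z ∈ slab d R v0, (1 / ‖io z‖) ^ d := by
          rw [Finset.mul_sum]
          refine Finset.sum_congr rfl fun z _ => ?_
          rw [← mul_pow, mul_one_div]
      _ ≤ _ := by gcongr
  have hinner : ∀ v0 ∈ ball0 d R,
      ∑ w ∈ (Fintype.piFinset fun _ : Fin k => slab d R v0).filter (good v0),
        ((Pts n v0 w).card : ℝ) ^ r ≤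
      CC k ^ r * (R ^ d * CS d) ^ k * (R / ‖io v0‖) ^ r := by
    intro v0 hv0
    calc _ ≤ ∑ w ∈ (Fintype.piFinset fun _ : Fin k => slab d R v0).filter (good v0),
          CC k ^ r * (R / ‖io v0‖) ^ r * ∏ i, ((R:ℝ) / ‖io (w i)‖) ^ d := by
          refine Finset.sum_le_sum fun w hw => ?_
          rw [Finset.mem_filter, Fintype.mem_piFinset] at hw
          have hg : ((Pts n v0 w).card : ℝ) ≤ CC k * ((R / ‖io v0‖) * ∏ i, (R / ‖io (w i)‖)) := hw.2
          have hC := CC_pos k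
          calc _ ≤ (CC k * ((R / ‖io v0‖) * ∏ i, (R / ‖io (w i)‖))) ^ r := by gcongr
            _ = CC k ^ r * (R / ‖io v0‖) ^ r * ∏ i, ((R:ℝ) / ‖io (w i)‖) ^ r := by
                rw [mul_pow, mul_pow, Finset.prod_pow, mul_assoc]
            _ ≤ _ := by
                gcongr with i
                have := hw.1 i
                rw [slab, Finset.mem_filter, mem_ball0] at this
                have h1 := one_le _ this.1.1
                rw [one_le_div (by linarith)]
                exact this.1.2
      _ ≤ ∑ w ∈ (Fintype.piFinset fun _ : Fin k => slab d R v0),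
          CC k ^ r * (R / ‖io v0‖) ^ r * ∏ i, ((R:ℝ) / ‖io (w i)‖) ^ d := by
          apply Finset.sum_le_sum_of_subset_of_nonneg (Finset.filter_subset _ _)
          intro w _ _
          have hC := CC_pos k
          positivity
      _ = CC k ^ r * (R / ‖io v0‖) ^ r * (∑ z ∈ slab d R v0, ((R:ℝ) / ‖io z‖) ^ d) ^ k := by
          rw [← Finset.mul_sum]
          congr 1
          rw [← Finset.prod_univ_sum (fun _ : Fin k => slab d R v0)
            (fun _ z => ((R:ℝ) / ‖io z‖) ^ d)]
          simp
      _ ≤ CC k ^ r * (R / ‖io v0‖) ^ r * (R ^ d * CS d) ^ k := by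
          have hC := CC_pos k
          gcongr
          exact hslab v0 hv0
      _ = _ := by ring
  calc ((tups d r n (k+1)).card : ℝ) ≤ ∑ v0 ∈ ball0 d R,
      ∑ w ∈ (Fintype.piFinset fun _ : Fin k => slab d R v0).filter (good v0),
        ((Pts n v0 w).card : ℝ) ^ r := by
        have h1 := (Finset.card_le_card hsub).trans (Finset.card_biUnion_le.trans
          (Finset.sum_le_sum fun v0 _ => Finset.card_biUnion_le))
        simp only [Fintype.card_piFinset, Finset.prod_const, Finset.card_univ,
          Fintype.card_fin] at h1
        exact_mod_cast h1
    _ ≤ ∑ v0 ∈ ball0 d R, CC k ^ r * (R ^ d * CS d) ^ k * (R / ‖io v0‖) ^ r :=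
        Finset.sum_le_sum hinner
    _ = CC k ^ r * (R ^ d * CS d) ^ k * ∑ v0 ∈ ball0 d R, ((R:ℝ) / ‖io v0‖) ^ r := by
        rw [Finset.mul_sum]
    _ ≤ CC k ^ r * (R ^ d * CS d) ^ k * (6 ^ d * R ^ d * lam d r R) := by
        have hC := CC_pos k
        have hS : 0 ≤ CS d := by unfold CS; positivity
        gcongr
        exact tsum_v0 hr hR _ fun z hz => mem_ball0.1 hz
    _ = _ := by rw [mul_pow, ← pow_mul, Nat.mul_succ, pow_add]; ring

/-- Deletion lemma via random colourings. -/
lemma deletion {α : Type*} [DecidableEq α] (B : Finset α) (H : Finset (Finset α)) (r q : ℕ)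
    (hr : 0 < r) (hq : 0 < q)
    (hH : ∀ h ∈ H, h ⊆ B ∧ h.card = r) (hcard : 2 * H.card ≤ B.card * q ^ (r-1)) :
    ∃ S ⊆ B, (∀ h ∈ H, ¬ h ⊆ S) ∧ (B.card : ℝ) / (2 * q) ≤ S.card := by
  classical
  have : NeZero q := ⟨hq.ne'⟩
  let mono : (B → Fin q) → Finset α → Fin q → Prop := fun f h c => ∀ a : B, (a : α) ∈ h → f a = c
  -- number of colourings making h monochromatic in a colour c
  have hcount : ∀ h ∈ H, ((Finset.univ : Finset (B → Fin q)).filter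
      (fun f => ∃ c, mono f h c)).card * q ^ (r-1) ≤ q ^ B.card := by
    intro h hh
    obtain ⟨hB, hc⟩ := hH h hh
    obtain ⟨a0, ha0⟩ : h.Nonempty := Finset.card_pos.1 (by omega)
    have hinj : Set.InjOn (fun (f : B → Fin q) => fun a : (B \ (h.erase a0) : Finset α) =>
        f ⟨a.1, (Finset.mem_sdiff.1 a.2).1⟩)
        ((Finset.univ : Finset (B → Fin q)).filter (fun f => ∃ c, mono f h c)) := by
      intro f hf g hg hfg
      simp only [Finset.coe_filter, Finset.mem_univ, true_and, Set.mem_ofPred_eq] at hf hg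
      obtain ⟨c, hc1⟩ := hf
      obtain ⟨c', hc2⟩ := hg
      have e0 : f ⟨a0, hB ha0⟩ = g ⟨a0, hB ha0⟩ :=
        congrFun hfg ⟨a0, Finset.mem_sdiff.2 ⟨hB ha0, by simp⟩⟩
      funext a
      by_cases ha : (a : α) ∈ h
      · rw [hc1 a ha, hc2 a ha, ← hc1 ⟨a0, hB ha0⟩ ha0, ← hc2 ⟨a0, hB ha0⟩ ha0, e0]
      · exact congrFun hfg ⟨a.1, Finset.mem_sdiff.2 ⟨a.2, fun h' => ha (Finset.mem_of_mem_erase h')⟩⟩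
    have h1 := Finset.card_le_card_of_injOn (t := Finset.univ) _ (fun _ _ => Finset.mem_univ _) hinj
    rw [Finset.card_univ, Fintype.card_fun, Fintype.card_fin, Fintype.card_coe] at h1
    have hsub : h.erase a0 ⊆ B := (Finset.erase_subset _ _).trans hB
    have h2 : (B \ (h.erase a0)).card + (r - 1) = B.card := by
      rw [Finset.card_sdiff_of_subset hsub, Finset.card_erase_of_mem ha0, hc]
      have := Finset.card_le_card hB
      omega
    calc _ ≤ q ^ (B \ (h.erase a0)).card * q ^ (r-1) := Nat.mul_le_mul_right _ h1
      _ = q ^ B.card := by rw [← pow_add, h2]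
  -- a good colouring
  obtain ⟨f, hf⟩ : ∃ f : B → Fin q, 2 * (H.filter fun h => ∃ c, mono f h c).card ≤ B.card := by
    by_contra! hcon
    have h1 : ∑ f : B → Fin q, B.card * q ^ (r-1) <
        ∑ f : B → Fin q, 2 * (H.filter fun h => ∃ c, mono f h c).card * q ^ (r-1) :=
      Finset.sum_lt_sum_of_nonempty Finset.univ_nonempty fun f _ =>
        Nat.mul_lt_mul_of_pos_right (hcon f) (by positivity)
    have h2 : ∑ f : B → Fin q, 2 * (H.filter fun h => ∃ c, mono f h c).card * q ^ (r-1) ≤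
        2 * H.card * q ^ B.card := by
      calc _ = ∑ f : B → Fin q, ∑ h ∈ H, if ∃ c, mono f h c then 2 * q ^ (r-1) else 0 := by
            refine Finset.sum_congr rfl fun f _ => ?_
            rw [← Finset.sum_filter, Finset.sum_const, smul_eq_mul]; ring
        _ = ∑ h ∈ H, 2 * (((Finset.univ : Finset (B → Fin q)).filter
              (fun f => ∃ c, mono f h c)).card * q ^ (r-1)) := by
            rw [Finset.sum_comm]
            refine Finset.sum_congr rfl fun h _ => ?_
            rw [← Finset.sum_filter, Finset.sum_const, smul_eq_mul]; ring
        _ ≤ ∑ h ∈ H, 2 * q ^ B.card := Finset.sum_le_sum fun h hh =>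
            Nat.mul_le_mul_left _ (hcount h hh)
        _ = _ := by rw [Finset.sum_const, smul_eq_mul]; ring
    rw [Finset.sum_const, Finset.card_univ, Fintype.card_fun, Fintype.card_fin, Fintype.card_coe,
      smul_eq_mul] at h1
    have h3 := Nat.mul_le_mul_right (q ^ B.card) hcard
    have := h1.trans_le (h2.trans h3)
    rw [mul_comm] at this
    exact lt_irrefl _ this
  -- classes
  let cl : Fin q → Finset B := fun c => Finset.univ.filter fun a => f a = c
  let Hc : Fin q → Finset (Finset α) := fun c => H.filter fun h => mono f h c
  have hsumcl : ∑ c, (cl c).card = B.card := by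
    rw [← Fintype.card_coe B, ← Finset.card_univ]
    exact (Finset.card_eq_sum_card_fiberwise (fun _ _ => Finset.mem_univ _)).symm
  have hsumH : ∑ c, (Hc c).card ≤ (H.filter fun h => ∃ c, mono f h c).card := by
    rw [← Finset.card_biUnion]
    · refine Finset.card_le_card fun h hh => ?_
      simp only [Hc, Finset.mem_biUnion, Finset.mem_univ, true_and, Finset.mem_filter] at hh ⊢
      obtain ⟨c, h1, h2⟩ := hh
      exact ⟨h1, c, h2⟩
    · intro c _ c' _ hne
      rw [Function.onFun, Finset.disjoint_left]
      intro h h1 h2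
      simp only [Hc, Finset.mem_filter] at h1 h2
      obtain ⟨hB, hc⟩ := hH h h1.1
      obtain ⟨a0, ha0⟩ : h.Nonempty := Finset.card_pos.1 (by omega)
      exact hne ((h1.2 ⟨a0, hB ha0⟩ ha0).symm.trans (h2.2 ⟨a0, hB ha0⟩ ha0))
  obtain ⟨c, hc⟩ : ∃ c, (B.card : ℝ) / (2 * q) ≤ (cl c).card - (Hc c).card := by
    by_contra! hcon
    have h1 : ∑ c : Fin q, (((cl c).card : ℝ) - (Hc c).card) < ∑ c : Fin q, (B.card : ℝ) / (2 * q) :=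
      Finset.sum_lt_sum_of_nonempty Finset.univ_nonempty fun c _ => hcon c
    rw [Finset.sum_sub_distrib, Finset.sum_const, Finset.card_univ, Fintype.card_fin,
      nsmul_eq_mul] at h1
    have h2 : (∑ c, ((cl c).card : ℝ)) = B.card := by exact_mod_cast hsumcl
    have h3 : 2 * (∑ c, ((Hc c).card : ℝ)) ≤ B.card := by
      exact_mod_cast (Nat.mul_le_mul_left 2 hsumH).trans hf
    have hq' : (0:ℝ) < q := by exact_mod_cast hq
    have h4 : (q:ℝ) * (B.card / (2 * q)) = B.card / 2 := by field_simp
    rw [h4, h2] at h1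
    linarith
  have hne : ∀ h : Finset α, ∃ a : Option α, ∀ h' : h.Nonempty, ∃ b ∈ h, a = some b := by
    intro h
    by_cases hh : h.Nonempty
    · obtain ⟨b, hb⟩ := hh
      exact ⟨some b, fun _ => ⟨b, hb, rfl⟩⟩
    · exact ⟨none, fun h' => absurd h' hh⟩
  choose pick hpick using hne
  let clα : Finset α := (cl c).map (Function.Embedding.subtype _)
  let D : Finset α := ((Hc c).image pick).eraseNone
  refine ⟨clα \ D, ?_, ?_, ?_⟩
  · intro a ha
    have := (Finset.mem_sdiff.1 ha).1
    simp only [clα, Finset.mem_map] at this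
    obtain ⟨b, _, rfl⟩ := this
    exact b.2
  · intro h hh hsub
    obtain ⟨hB, hcd⟩ := hH h hh
    obtain ⟨b, hb, hb2⟩ := hpick h (Finset.card_pos.1 (by omega))
    have hm : mono f h c := by
      intro a ha
      have := (Finset.mem_sdiff.1 (hsub ha)).1
      simp only [clα, Finset.mem_map] at this
      obtain ⟨a', ha', hh'⟩ := this
      have : a' = a := Subtype.ext hh'
      rw [← this]
      simpa [cl] using ha'
    apply (Finset.mem_sdiff.1 (hsub hb)).2
    simp only [D, Finset.mem_eraseNone, Finset.mem_image]
    exact ⟨h, Finset.mem_filter.2 ⟨hh, hm⟩, hb2⟩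
  · refine hc.trans ?_
    have h1 : D.card ≤ (Hc c).card :=
      (Finset.card_eraseNone_le _).trans Finset.card_image_le
    have h2 := Finset.le_card_sdiff D clα
    have h3 : clα.card = (cl c).card := Finset.card_map _
    have h4 : (cl c).card ≤ (clα \ D).card + (Hc c).card := by omega
    have h5 : ((cl c).card : ℝ) ≤ (clα \ D).card + (Hc c).card := by exact_mod_cast h4
    linarith

noncomputable def Lam (d r n : ℕ) : ℝ := if r < d then 1 else Real.log n

lemma one_le_log {n : ℕ} (hn : 3 ≤ n) : 1 ≤ Real.log n := by
  rw [Real.le_log_iff_exp_le (by positivity)]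
  have h1 := Real.exp_one_lt_d9
  have h2 : (3:ℝ) ≤ n := by exact_mod_cast hn
  linarith

lemma one_le_Lam {d r n : ℕ} (hn : 3 ≤ n) : 1 ≤ Lam d r n := by
  unfold Lam
  split_ifs
  · exact le_rfl
  · exact one_le_log hn

lemma lam_le {d r n : ℕ} (hd : 0 < d) (hn : 3 ≤ n) :
    lam d r (d * n) ≤ (2 * d + 3) * Lam d r n := by
  have hd' : (1:ℝ) ≤ d := by exact_mod_cast hd
  unfold lam Lam
  split_ifs
  · linarith
  · have h1 := Real.natLog_le_logb (d * n) 2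
    have hl := one_le_log hn
    have hn0 : (n:ℝ) ≠ 0 := by positivity
    rw [Real.logb, Nat.cast_mul, Real.log_mul (by positivity) hn0] at h1
    have h2 : Real.log d ≤ d := (Real.log_le_sub_one_of_pos (by positivity)).trans (by linarith)
    have h3 : (1:ℝ) / 2 ≤ Real.log 2 := by linarith [Real.log_two_gt_d9]
    have h4 : (Real.log d + Real.log n) / Real.log (2:ℕ) ≤ 2 * (d + Real.log n) := by
      have h5 : 0 ≤ Real.log d := Real.log_nonneg hd'
      rw [div_le_iff₀ (by push_cast; linarith)]
      push_cast
      nlinarith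
    nlinarith

open Classical in
noncomputable def HH (d r n k : ℕ) : Finset (Finset (Fin d → ℤ)) :=
  ((box d n).powersetCard r).filter fun h =>
    finrank ℝ (Submodule.span ℝ (io '' (h : Set (Fin d → ℤ)))) ≤ k

lemma card_HH {d k r : ℕ} (hd : 0 < d) (hr0 : 0 < r) (hr : r ≤ d) :
    ∃ C : ℝ, 1 ≤ C ∧ ∀ n : ℕ, 3 ≤ n →
      ((HH d r n k).card : ℝ) ≤ C * (n:ℝ) ^ (d * k) * Lam d r n := by
  classical
  let K : ℕ → ℝ := fun j => CC j ^ r * CS d ^ j * 6 ^ d * (d:ℝ) ^ (d * (j+1)) * (2 * d + 3)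
  have hK : ∀ j, 0 ≤ K j := fun j => by
    have := CC_pos j
    have hS : 0 ≤ CS d := by unfold CS; positivity
    positivity
  refine ⟨∑ j ∈ Finset.range k, K j + 1,
    by linarith [Finset.sum_nonneg fun j (_ : j ∈ Finset.range k) => hK j], ?_⟩
  intro n hn
  have hL := one_le_Lam (d := d) (r := r) hn
  have hsub : HH d r n k ⊆ (Finset.range k).biUnion fun j =>
      (tups d r n (j+1)).image fun x => Finset.univ.image x := by
    intro h hh
    simp only [HH, Finset.mem_filter, Finset.mem_powersetCard] at hh
    obtain ⟨⟨hB, hc⟩, hrk⟩ := hh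
    let e := (h.equivFinOfCardEq hc).symm
    let x : Fin r → Fin d → ℤ := fun l => (e l : Fin d → ℤ)
    have himg : Finset.univ.image x = h := by
      ext z
      simp only [Finset.mem_image, Finset.mem_univ, true_and, x]
      constructor
      · rintro ⟨l, rfl⟩; exact (e l).2
      · intro hz; exact ⟨e.symm ⟨z, hz⟩, by simp⟩
    have hrange : (Set.range fun l => io (x l)) = io '' (h : Set (Fin d → ℤ)) := by
      rw [← himg]
      ext z; simp
    have hpos : finrank ℝ (Submodule.span ℝ (io '' (h : Set (Fin d → ℤ)))) ≠ 0 := by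
      intro h0
      rw [Submodule.finrank_eq_zero, Submodule.span_eq_bot] at h0
      have hx0 : x ⟨0, hr0⟩ ∈ h := (e _).2
      have h1 := h0 _ ⟨_, hx0, rfl⟩
      have h2 := mem_box.1 (hB hx0) ⟨0, hd⟩
      rw [← io_zero] at h1
      have h3 := congrFun (io_inj h1) ⟨0, hd⟩
      rw [h3] at h2
      simp at h2
    obtain ⟨j, hj⟩ := Nat.exists_eq_succ_of_ne_zero hpos
    simp only [Finset.mem_biUnion, Finset.mem_range, Finset.mem_image]
    refine ⟨j, by omega, x, ?_, himg⟩
    simp only [tups, Finset.mem_filter, Fintype.mem_piFinset]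
    refine ⟨fun l => hB (e l).2, ?_⟩
    rw [hrange, hj]
  have hn1 : (1:ℝ) ≤ n := by exact_mod_cast (by omega : 1 ≤ n)
  calc ((HH d r n k).card : ℝ) ≤ ∑ j ∈ Finset.range k, ((tups d r n (j+1)).card : ℝ) := by
        exact_mod_cast (Finset.card_le_card hsub).trans (Finset.card_biUnion_le.trans
          (Finset.sum_le_sum fun j _ => Finset.card_image_le))
    _ ≤ ∑ j ∈ Finset.range k, K j * ((n:ℝ) ^ (d * k) * Lam d r n) := by
        refine Finset.sum_le_sum fun j hj => ?_
        refine (card_tups hd hr (by omega)).trans ?_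
        have hC := CC_pos j
        have hS : 0 ≤ CS d := by unfold CS; positivity
        calc _ ≤ CC j ^ r * CS d ^ j * 6 ^ d * ((d:ℝ) ^ (d * (j+1)) * (n:ℝ) ^ (d * k)) *
              ((2 * d + 3) * Lam d r n) := by
              push_cast
              rw [mul_pow]
              gcongr
              · unfold lam; split_ifs <;> positivity
              · have := Finset.mem_range.1 hj; omega
              · exact lam_le hd hn
          _ = _ := by simp only [K]; ring
    _ = (∑ j ∈ Finset.range k, K j) * ((n:ℝ) ^ (d * k) * Lam d r n) := by rw [Finset.sum_mul]
    _ ≤ (∑ j ∈ Finset.range k, K j + 1) * ((n:ℝ) ^ (d * k) * Lam d r n) := by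
        gcongr; linarith
    _ = _ := by ring

lemma core (d k r : ℕ) (hk : 0 < k) (hkr : k + 1 ≤ r) (hr : r ≤ d) :
    ∃ c : ℝ, 0 < c ∧ ∀ n : ℕ, 3 ≤ n →
      ∃ S : Set (EuclideanSpace ℝ (Fin d)),
        S ⊆ grid d n ∧
        c * ((n : ℝ) ^ ((d : ℝ) * ((r : ℝ) - (k : ℝ)) / ((r : ℝ) - 1)) /
          Lam d r n ^ ((1 : ℝ) / ((r : ℝ) - 1))) ≤ S.ncard ∧
        ∀ W : Submodule ℝ (EuclideanSpace ℝ (Fin d)),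
          Module.finrank ℝ W ≤ k →
            (S ∩ (W : Set (EuclideanSpace ℝ (Fin d)))).ncard ≤ r - 1 := by
  classical
  obtain ⟨C, hC1, hC⟩ := card_HH (d := d) (k := k) (r := r) (by omega) (by omega) hr
  obtain ⟨p, rfl⟩ : ∃ p, r = p + 1 := ⟨r - 1, by omega⟩
  obtain ⟨k', rfl⟩ : ∃ k', k = k' + 1 := ⟨k - 1, by omega⟩
  have hp : 0 < p := by omega
  have hp' : (p:ℝ) ≠ 0 := by positivity
  refine ⟨1 / (4 * (2 * C) ^ ((1:ℝ) / p)), by positivity, ?_⟩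
  intro n hn
  have hL := one_le_Lam (d := d) (r := p+1) hn
  have hn1 : (1:ℝ) ≤ n := by exact_mod_cast (by omega : 1 ≤ n)
  set Λ := Lam d (p+1) n with hΛ
  set Y : ℝ := (2 * C) * ((n:ℝ) ^ (d * k') * Λ) with hY
  have hY1 : 1 ≤ Y := by
    have h1 : (1:ℝ) ≤ (n:ℝ) ^ (d * k') := one_le_pow₀ hn1
    have h2 : (1:ℝ) ≤ (n:ℝ) ^ (d * k') * Λ := by nlinarith
    rw [hY]; nlinarith
  set Q : ℝ := Y ^ ((1:ℝ) / p) with hQ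
  have hQ1 : 1 ≤ Q := Real.one_le_rpow hY1 (by positivity)
  have hQp : Q ^ p = Y := by
    rw [hQ, ← Real.rpow_natCast, ← Real.rpow_mul (by linarith)]
    rw [one_div_mul_cancel hp', Real.rpow_one]
  set q : ℕ := ⌈Q⌉₊ with hq
  have hqQ : Q ≤ q := Nat.le_ceil _
  have hq2 : (q:ℝ) ≤ 2 * Q := by
    have := Nat.ceil_lt_add_one (by linarith : (0:ℝ) ≤ Q)
    linarith
  have hq0 : 0 < q := Nat.ceil_pos.2 (by linarith)
  have hbox : (box d n).card = n ^ d := by simp [box]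
  obtain ⟨S, hSB, hSH, hScard⟩ := deletion (box d n) (HH d (p+1) n (k'+1)) (p+1) q (by omega) hq0
    (fun h hh => by
      simp only [HH, Finset.mem_filter, Finset.mem_powersetCard] at hh
      exact hh.1) (by
      have h1 : (2:ℝ) * (HH d (p+1) n (k'+1)).card ≤ (n:ℝ) ^ d * (q:ℝ) ^ p := by
        calc (2:ℝ) * (HH d (p+1) n (k'+1)).card ≤ 2 * (C * (n:ℝ) ^ (d * (k'+1)) * Λ) := by
              gcongr; exact hC n hn
          _ = (n:ℝ) ^ d * Q ^ p := by rw [hQp, hY, Nat.mul_succ, pow_add]; ring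
          _ ≤ _ := by gcongr
      rw [hbox, Nat.add_sub_cancel]
      exact_mod_cast h1)
  refine ⟨io '' (S : Set (Fin d → ℤ)), ?_, ?_, ?_⟩
  · rintro _ ⟨z, hz, rfl⟩ i
    have := mem_box.1 (hSB hz) i
    refine ⟨(z i).toNat, by omega, by omega, ?_⟩
    rw [io_apply]
    have h0 : (((z i).toNat : ℕ) : ℤ) = z i := Int.toNat_of_nonneg (by omega)
    calc ((z i : ℤ) : ℝ) = ((((z i).toNat : ℕ) : ℤ) : ℝ) := by rw [h0]
      _ = _ := Int.cast_natCast _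
  · rw [Set.ncard_image_of_injective _ io_inj, Set.ncard_coe_finset]
    refine le_trans ?_ hScard
    rw [hbox]
    have hnpos : (0:ℝ) < n := by linarith
    have e1 : Q = (2 * C) ^ ((1:ℝ) / p) * ((n:ℝ) ^ ((d:ℝ) * k' / p) * Λ ^ ((1:ℝ) / p)) := by
      rw [hQ, hY, Real.mul_rpow (by positivity) (by positivity),
        Real.mul_rpow (x := (n:ℝ) ^ (d * k')) (by positivity) (by positivity), ← Real.rpow_natCast, ← Real.rpow_mul hnpos.le]
      push_cast
      rw [mul_one_div]
    have e2 : (n:ℝ) ^ ((d : ℝ) * (((p+1 : ℕ) : ℝ) - ((k'+1 : ℕ) : ℝ)) / (((p+1 : ℕ) : ℝ) - 1)) =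
        (n:ℝ) ^ d / (n:ℝ) ^ ((d:ℝ) * k' / p) := by
      rw [← Real.rpow_natCast (n:ℝ) d, ← Real.rpow_sub hnpos]
      congr 1
      push_cast
      rw [add_sub_cancel_right, add_sub_add_right_eq_sub]
      field_simp
    have e3 : (((p+1 : ℕ) : ℝ) - 1) = p := by push_cast; ring
    rw [e2, e3]
    push_cast
    calc _ = (n:ℝ) ^ d / (2 * (2 * Q)) := by
          rw [e1]
          have h1 : 0 < (2 * C) ^ ((1:ℝ) / p) := by positivity
          have h2 : 0 < (n:ℝ) ^ ((d:ℝ) * k' / p) := by positivity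
          have h3 : 0 < Λ ^ ((1:ℝ) / p) := by positivity
          generalize (2 * C) ^ ((1:ℝ) / p) = a at *
          generalize (n:ℝ) ^ ((d:ℝ) * k' / p) = b at *
          generalize Λ ^ ((1:ℝ) / p) = c at *
          field_simp
          norm_num
      _ ≤ _ := by
          have : (0:ℝ) < q := by exact_mod_cast hq0
          gcongr
  · intro W hW
    by_contra! hcon
    have e1 : io '' (S : Set (Fin d → ℤ)) ∩ (W : Set (E d)) =
        io '' ((S.filter fun z => io z ∈ W : Finset (Fin d → ℤ)) : Set (Fin d → ℤ)) := by
      ext y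
      simp only [Set.mem_inter_iff, Set.mem_image, Finset.coe_filter, Set.mem_ofPred_eq,
        SetLike.mem_coe]
      constructor
      · rintro ⟨⟨z, hz, rfl⟩, hy⟩; exact ⟨z, ⟨hz, hy⟩, rfl⟩
      · rintro ⟨z, ⟨hz, hy⟩, rfl⟩; exact ⟨⟨z, hz, rfl⟩, hy⟩
    rw [e1, Set.ncard_image_of_injective _ io_inj, Set.ncard_coe_finset] at hcon
    obtain ⟨h, hsub, hcd⟩ := Finset.exists_subset_card_eq (show p + 1 ≤ (S.filter fun z => io z ∈ W).card by omega)
    apply hSH h _ (hsub.trans (Finset.filter_subset _ _))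
    simp only [HH, Finset.mem_filter, Finset.mem_powersetCard]
    refine ⟨⟨hsub.trans ((Finset.filter_subset _ _).trans hSB), hcd⟩, ?_⟩
    refine (Submodule.finrank_mono ?_).trans hW
    rw [Submodule.span_le]
    rintro _ ⟨z, hz, rfl⟩
    exact (Finset.mem_filter.1 (hsub hz)).2
end LE

theorem linear_evasive_lower_bound (d k r : ℕ) (hd : 0 < d) (hk : 0 < k) (hr : 0 < r)
    (hkd : k < d) (hrk : k + 1 ≤ r) :
    ∃ c : ℝ, 0 < c ∧ ∃ N : ℕ, ∀ n ≥ N,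
      ∃ S : Set (EuclideanSpace ℝ (Fin d)),
        S ⊆ grid d n ∧ c * gdkr d k r n ≤ S.ncard ∧
        ∀ W : Submodule ℝ (EuclideanSpace ℝ (Fin d)),
          Module.finrank ℝ W ≤ k → (S ∩ (W : Set (EuclideanSpace ℝ (Fin d)))).ncard ≤ r - 1 := by
  by_cases hrd : r < d
  · obtain ⟨c, hc, h⟩ := LE.core d k r hk hrk hrd.le
    refine ⟨c, hc, 3, fun n hn => ?_⟩
    obtain ⟨S, h1, h2, h3⟩ := h n hn
    refine ⟨S, h1, ?_, h3⟩
    simpa [gdkr, LE.Lam, hrd] using h2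
  · obtain ⟨c, hc, h⟩ := LE.core d k d hk hkd le_rfl
    refine ⟨c, hc, 3, fun n hn => ?_⟩
    obtain ⟨S, h1, h2, h3⟩ := h n hn
    refine ⟨S, h1, ?_, fun W hW => (h3 W hW).trans (by omega)⟩
    simpa [gdkr, LE.Lam, hrd] using h2
end
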